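/- arXiv:2505.06550 — 2 statements merged into one kernel-verified Lean document; each statement's English description precedes it below -/
import Mathlib

section
/- For all k, t ∈ ℕ, there exists k' ∈ ℕ such that the following holds: if G is a finite simple K_{t,t}-free graph such that every induced subgraph of G admits (k, 1)-balanced separators, then G has a (k', 2)-centred tree-decomposition. (One may take k' = 20dk with d = (512·20k)^{(2k+2)^{2t}}.) -/
open SimpleGraph
open scoped ENNReal NNReal

/-- The set of vertices of `G` at graph-distance at most `r` from the set `S`. -/
def ballAround {V : Type*} (G : SimpleGraph V) (S : Set V) (r : ℕ) : Set V :=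
  {v | ∃ u ∈ S, G.edist u v ≤ (r : ℕ∞)}

/-- A set `S` is `(k, r)`-centred in `G` if it is contained in the union of the balls of
radius `r` around at most `k` vertices. -/
def IsCentred {V : Type*} (G : SimpleGraph V) (k r : ℕ) (S : Set V) : Prop :=
  ∃ T : Set V, T.ncard ≤ k ∧ S ⊆ ballAround G T r

/-- `S` is a balanced separator for the weight function `μ`: every connected component of
`G - S` carries at most half of the total weight. -/
def IsBalancedSeparator {V : Type*} (G : SimpleGraph V) (μ : V → NNReal) (S : Set V) : Prop :=
  ∀ C : (G.induce Sᶜ).ConnectedComponent,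
    (∑ᶠ v ∈ C.supp, μ (v : V)) ≤ (∑ᶠ v : V, μ v) / 2

/-- `G` admits `(k, r)`-balanced separators: for every weight function there is a
`(k, r)`-centred balanced separator. -/
def AdmitsBalancedSeparators {V : Type*} (G : SimpleGraph V) (k r : ℕ) : Prop :=
  ∀ μ : V → NNReal, ∃ S : Set V, IsCentred G k r S ∧ IsBalancedSeparator G μ S

/-- A tree-decomposition of `G` with nodes indexed by `τ`. -/
structure TreeDecomp {V : Type*} (G : SimpleGraph V) (τ : Type*) where
  tree : SimpleGraph τ
  isTree : tree.IsTree
  bag : τ → Set V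
  covers_edge : ∀ ⦃u w : V⦄, G.Adj u w → ∃ x : τ, u ∈ bag x ∧ w ∈ bag x
  covers_vertex : ∀ v : V, ∃ x : τ, v ∈ bag x
  bags_connected : ∀ v : V, (tree.induce {x : τ | v ∈ bag x}).Connected

/-- `G` has a tree-decomposition of width at most `w`. -/
def HasTreeDecompOfWidth {V : Type*} (G : SimpleGraph V) (w : ℕ) : Prop :=
  ∃ (τ : Type) (_ : Fintype τ) (D : TreeDecomp G τ), ∀ x : τ, (D.bag x).ncard ≤ w + 1

/-- The treewidth of `G`. -/
noncomputable def treewidth {V : Type*} (G : SimpleGraph V) : ℕ :=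
  sInf {w : ℕ | HasTreeDecompOfWidth G w}

/-- The separation number of `G`. -/
noncomputable def sepNum {V : Type*} (G : SimpleGraph V) : ℕ :=
  sInf {m : ℕ | ∀ μ : V → NNReal, ∃ S : Set V, S.ncard ≤ m ∧ IsBalancedSeparator G μ S}

/-- `φ` is a `q`-quasi-isometry from `G` to `H`. -/
def IsQuasiIsometry {V W : Type*} (q : ℕ) (G : SimpleGraph V) (H : SimpleGraph W)
    (φ : V → W) : Prop :=
  (∀ u v : V,
      (q : ℝ≥0∞)⁻¹ * (G.edist u v : ℝ≥0∞) - (q : ℝ≥0∞) ≤ (H.edist (φ u) (φ v) : ℝ≥0∞) ∧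
      (H.edist (φ u) (φ v) : ℝ≥0∞) ≤ (q : ℝ≥0∞) * (G.edist u v : ℝ≥0∞) + (q : ℝ≥0∞)) ∧
  ∀ x : W, ∃ v : V, H.edist x (φ v) ≤ (q : ℕ∞)

/-- The 2-subdivision of a graph `H`: each edge is replaced by a path of length 3.
The internal vertex `Sum.inr ⟨(a, b), _⟩` is the subdivision vertex on the edge `ab`
that is adjacent to `a`. -/
def twoSubdivision {V : Type*} (H : SimpleGraph V) :
    SimpleGraph (V ⊕ {p : V × V // H.Adj p.1 p.2}) :=
  SimpleGraph.fromRel fun a b =>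
    match a, b with
    | Sum.inl x, Sum.inr p => x = p.1.1
    | Sum.inr p, Sum.inr q => p.1.1 = q.1.2 ∧ p.1.2 = q.1.1
    | _, _ => False

/-- The largest size of an independent set of `G` contained in `Y`. -/
noncomputable def indepNumOn {V : Type*} (G : SimpleGraph V) (Y : Set V) : ℕ :=
  sSup {n : ℕ | ∃ s ⊆ Y, s.ncard = n ∧ s.Pairwise fun u v => ¬ G.Adj u v}

section Decomposition

variable {V : Type}

/-- The vertices `u` and `v` are equal or adjacent. -/
def Close (G : SimpleGraph V) (u v : V) : Prop := u = v ∨ G.Adj u v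

/-- The vertices outside `C` with a neighbour in `C`. -/
def outerBoundary (G : SimpleGraph V) (C : Set V) : Set V :=
  {u | u ∉ C ∧ ∃ v ∈ C, G.Adj v u}

/-- The vertices in or adjacent to `S`. -/
def closedNbhd (G : SimpleGraph V) (S : Set V) : Set V := {v | ∃ u ∈ S, Close G u v}

/-- The vertices of `C` joined to `A` by a path of length at most two whose vertices,
except possibly the one in `A`, lie in `C`. -/
def relBall (G : SimpleGraph V) (C A : Set V) : Set V :=
  {b | b ∈ C ∧ ∃ a ∈ A, Close G a b ∨ ∃ c ∈ C, G.Adj a c ∧ G.Adj c b}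

/-- Every nonempty part of `D` that is closed under adjacency inside `D` is all of `D`. -/
def ConnectedOn (G : SimpleGraph V) (D : Set V) : Prop :=
  ∀ S : Set V, (D ∩ S).Nonempty → (∀ x ∈ D ∩ S, ∀ y ∈ D, G.Adj x y → y ∈ S) → D ⊆ S

/-- A rooted tree-decomposition of the graph formed by the edges meeting `C`, with
`(m, 2)`-centred bags and with the boundary of `C` contained in the root bag. -/
structure RootedDecomp (G : SimpleGraph V) (m : ℕ) (C : Set V) (τ : Type) where
  root : τ
  parent : τ → τ
  depth : τ → ℕ
  bag : τ → Set V
  depth_parent : ∀ x, x ≠ root → depth (parent x) < depth x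
  centred : ∀ x, IsCentred G m 2 (bag x)
  bag_subset : ∀ x, bag x ⊆ C ∪ outerBoundary G C
  boundary_subset : outerBoundary G C ⊆ bag root
  covers : ∀ u ∈ C, ∀ w, G.Adj u w → ∃ x, u ∈ bag x ∧ w ∈ bag x
  top : ∀ v ∈ C, ∃ t, v ∈ bag t ∧
    ∀ x, v ∈ bag x → x ≠ t → x ≠ root ∧ v ∈ bag (parent x)
  boundary_closed : ∀ v ∈ outerBoundary G C, ∀ x, v ∈ bag x → x ≠ root → v ∈ bag (parent x)

/-- The set `C` has a finite rooted decomposition with `(m, 2)`-centred bags. -/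
def Decomposable (G : SimpleGraph V) (m : ℕ) (C : Set V) : Prop :=
  ∃ (τ : Type) (_ : Fintype τ), Nonempty (RootedDecomp G m C τ)

theorem decomposable_empty (G : SimpleGraph V) (m : ℕ) : Decomposable G m ∅ := by
  have hb : outerBoundary G (∅ : Set V) = ∅ := by ext; simp [outerBoundary]
  refine ⟨Unit, inferInstance, ⟨{
    root := ()
    parent := id
    depth := fun _ => 0
    bag := fun _ => ∅
    depth_parent := fun x hx => (hx rfl).elim
    centred := fun _ => ⟨∅, by simp, by simp⟩
    bag_subset := by simp
    boundary_subset := by simp [hb]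
    covers := by simp
    top := by simp
    boundary_closed := by simp }⟩⟩

theorem decomposable_of_parts {G : SimpleGraph V} {m : ℕ} {C X : Set V} {ι : Type} [Finite ι]
    (D : ι → Set V) (hsub : ∀ i, D i ⊆ C \ X) (hcov : ∀ v ∈ C \ X, ∃ i, v ∈ D i)
    (hdisj : ∀ i j v, v ∈ D i → v ∈ D j → i = j)
    (hbd : ∀ i, ∀ v ∈ outerBoundary G (D i), v ∉ C \ X)
    (hcen : IsCentred G m 2 (outerBoundary G C ∪ C ∩ X))
    (hdec : ∀ i, Decomposable G m (D i)) : Decomposable G m C := by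
  classical
  choose τ hτ hR using hdec
  let R : ∀ i, RootedDecomp G m (D i) (τ i) := fun i => (hR i).some
  have hι : Fintype ι := Fintype.ofFinite ι
  have hbd' : ∀ i, outerBoundary G (D i) ⊆ outerBoundary G C ∪ C ∩ X := by
    intro i v hv
    by_cases hvC : v ∈ C
    · right
      refine ⟨hvC, ?_⟩
      by_contra hvX
      exact hbd i v hv ⟨hvC, hvX⟩
    · left
      obtain ⟨-, u, hu, huv⟩ := hv
      exact ⟨hvC, u, (hsub i hu).1, huv⟩
  have hout : ∀ i y v, v ∈ (R i).bag y → v ∉ D i → v ∈ outerBoundary G (D i) := fun i y v hv hvD =>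
    ((R i).bag_subset y hv).resolve_left hvD
  let par : Option (Σ i, τ i) → Option (Σ i, τ i) := fun x => match x with
    | none => none
    | some ⟨i, y⟩ => if y = (R i).root then none else some ⟨i, (R i).parent y⟩
  let dep : Option (Σ i, τ i) → ℕ := fun x => match x with
    | none => 0
    | some ⟨i, y⟩ => (R i).depth y + 1
  let bg : Option (Σ i, τ i) → Set V := fun x => match x with
    | none => outerBoundary G C ∪ C ∩ X
    | some ⟨i, y⟩ => (R i).bag y
  have hparent : ∀ i y v, v ∈ (R i).bag y → v ∉ D i → v ∈ bg (par (some ⟨i, y⟩)) := by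
    intro i y v hv hvD
    have hvo := hout i y v hv hvD
    by_cases hy : y = (R i).root
    · have : par (some ⟨i, y⟩) = none := by simp [par, hy]
      rw [this]
      exact hbd' i hvo
    · have : par (some ⟨i, y⟩) = some ⟨i, (R i).parent y⟩ := by simp [par, hy]
      rw [this]
      exact (R i).boundary_closed v hvo y hv hy
  refine ⟨Option (Σ i, τ i), inferInstance, ⟨{
    root := none
    parent := par
    depth := dep
    bag := bg
    depth_parent := ?_
    centred := ?_
    bag_subset := ?_
    boundary_subset := ?_
    covers := ?_
    top := ?_
    boundary_closed := ?_ }⟩⟩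
  · rintro (_ | ⟨i, y⟩) hx
    · exact (hx rfl).elim
    · by_cases hy : y = (R i).root
      · simp [par, dep, hy]
      · simpa [par, dep, hy] using (R i).depth_parent y hy
  · rintro (_ | ⟨i, y⟩)
    · exact hcen
    · exact (R i).centred y
  · rintro (_ | ⟨i, y⟩) v hv
    · rcases hv with hv | hv
      · exact Or.inr hv
      · exact Or.inl hv.1
    · rcases (R i).bag_subset y hv with hv | hv
      · exact Or.inl (hsub i hv).1
      · rcases hbd' i hv with hv | hv
        · exact Or.inr hv
        · exact Or.inl hv.1
  · exact Set.subset_union_left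
  · intro u hu w huw
    by_cases huX : u ∈ X
    · by_cases hwC : w ∈ C
      · by_cases hwX : w ∈ X
        · exact ⟨none, Or.inr ⟨hu, huX⟩, Or.inr ⟨hwC, hwX⟩⟩
        · obtain ⟨i, hi⟩ := hcov w ⟨hwC, hwX⟩
          obtain ⟨x, hx⟩ := (R i).covers w hi u huw.symm
          exact ⟨some ⟨i, x⟩, hx.2, hx.1⟩
      · exact ⟨none, Or.inr ⟨hu, huX⟩, Or.inl ⟨hwC, u, hu, huw⟩⟩
    · obtain ⟨i, hi⟩ := hcov u ⟨hu, huX⟩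
      obtain ⟨x, hx⟩ := (R i).covers u hi w huw
      exact ⟨some ⟨i, x⟩, hx⟩
  · intro v hv
    by_cases hvX : v ∈ X
    · refine ⟨none, Or.inr ⟨hv, hvX⟩, ?_⟩
      rintro (_ | ⟨i, y⟩) hx hne
      · exact (hne rfl).elim
      · exact ⟨hne, hparent i y v hx fun h => (hsub i h).2 hvX⟩
    · obtain ⟨i, hi⟩ := hcov v ⟨hv, hvX⟩
      obtain ⟨s, hs, hs'⟩ := (R i).top v hi
      have hvB : v ∉ outerBoundary G C ∪ C ∩ X := by
        rintro (h | h)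
        · exact h.1 hv
        · exact hvX h.2
      refine ⟨some ⟨i, s⟩, hs, ?_⟩
      rintro (_ | ⟨j, y⟩) hx hne
      · exact (hvB hx).elim
      · by_cases hvj : v ∈ D j
        · obtain rfl := hdisj i j v hi hvj
          have hys : y ≠ s := by
            rintro rfl
            exact hne rfl
          obtain ⟨hy, hp⟩ := hs' y hx hys
          refine ⟨by simp, ?_⟩
          have : par (some ⟨i, y⟩) = some ⟨i, (R i).parent y⟩ := by simp [par, hy]
          rw [this]
          exact hp
        · exact (hvB (hbd' j (hout j y v hx hvj))).elim
  · rintro v hv (_ | ⟨i, y⟩) hx hne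
    · exact (hne rfl).elim
    · exact hparent i y v hx fun h => hv.1 (hsub i h).1

theorem exists_not_decomposable_component [Finite V] {G : SimpleGraph V} {m : ℕ} {C X : Set V}
    (hC : ¬ Decomposable G m C) (hcen : IsCentred G m 2 (outerBoundary G C ∪ C ∩ X)) :
    ∃ D ⊆ C \ X, ¬ Decomposable G m D ∧ (∀ u ∈ outerBoundary G D, u ∈ C → u ∈ X) ∧
      ConnectedOn G D := by
  by_contra! hcon
  apply hC
  let D : (G.induce (C \ X)).ConnectedComponent → Set V := fun c => Subtype.val '' c.supp
  have hmem : ∀ c v (hv : v ∈ C \ X),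
      v ∈ D c ↔ (G.induce (C \ X)).connectedComponentMk ⟨v, hv⟩ = c := by
    intro c v hv
    constructor
    · rintro ⟨u, hu, rfl⟩
      exact hu
    · intro h
      exact ⟨⟨v, hv⟩, h, rfl⟩
  have hsub : ∀ c, D c ⊆ C \ X := by
    rintro c _ ⟨u, -, rfl⟩
    exact u.2
  have hbd : ∀ c, ∀ v ∈ outerBoundary G (D c), v ∉ C \ X := by
    rintro c v ⟨hvD, u, hu, huv⟩ hv
    apply hvD
    rw [hmem c v hv]
    have hu' := (hmem c u (hsub c hu)).1 hu
    rw [← hu']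
    apply ConnectedComponent.connectedComponentMk_eq_of_adj
    exact huv.symm
  refine decomposable_of_parts D hsub (fun v hv => ⟨_, (hmem _ v hv).2 rfl⟩)
    (fun i j v hi hj => ?_) hbd hcen fun c => ?_
  · rw [← (hmem i v (hsub i hi)).1 hi, ← (hmem j v (hsub i hi)).1 hj]
  · by_contra hbad
    refine hcon (D c) (hsub c) hbad (fun u hu huC => ?_) fun S hS hclosed => ?_
    · by_contra huX
      exact hbd c u hu ⟨huC, huX⟩
    · obtain ⟨s, hsD, hsS⟩ := hS
      have hwalk : ∀ x y : ↥(C \ X), (G.induce (C \ X)).Walk x y →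
          x.1 ∈ D c ∩ S → y.1 ∈ D c ∩ S := by
        intro x y w
        induction w with
        | nil => exact id
        | @cons x y z h _ ih =>
          intro hx
          apply ih
          have hy : y.1 ∈ D c := by
            by_contra hy
            exact hbd c y.1 ⟨hy, x.1, hx.1, h⟩ y.2
          exact ⟨hy, hclosed x hx y hy h⟩
      intro v hv
      have h1 := (hmem c s (hsub c hsD)).1 hsD
      have h2 := (hmem c v (hsub c hv)).1 hv
      obtain ⟨w⟩ := ConnectedComponent.exact (h1.trans h2.symm)
      exact (hwalk _ _ w ⟨hsD, hsS⟩).2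

end Decomposition

section Tree

variable {V : Type}

theorem exists_treeDecomp_of_decomposable_univ {G : SimpleGraph V} {m : ℕ}
    (h : Decomposable G m Set.univ) :
    ∃ (τ : Type) (_ : Fintype τ) (D : TreeDecomp G τ), ∀ x : τ, IsCentred G m 2 (D.bag x) := by
  classical
  obtain ⟨τ, hτ, ⟨R⟩⟩ := h
  have hne : ∀ x, x ≠ R.root → x ≠ R.parent x := fun x hx h => by
    have := R.depth_parent x hx
    rw [← h] at this
    exact lt_irrefl _ this
  let F : SimpleGraph τ := SimpleGraph.fromRel fun x y => x ≠ R.root ∧ R.parent x = y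
  have hadj : ∀ x, x ≠ R.root → F.Adj x (R.parent x) := fun x hx =>
    (SimpleGraph.fromRel_adj _ _ _).2 ⟨hne x hx, Or.inl ⟨hx, rfl⟩⟩
  have hconn : F.Connected := by
    rw [connected_iff_exists_forall_reachable]
    refine ⟨R.root, fun x => ?_⟩
    induction hn : R.depth x using Nat.strong_induction_on generalizing x with
    | _ n ih =>
      by_cases hx : x = R.root
      · rw [hx]
      · have hd := R.depth_parent x hx
        exact (ih _ (hn ▸ hd) _ rfl).trans (hadj x hx).symm.reachable
  have htree : F.IsTree := by
    rw [isTree_iff_connected_and_card]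
    refine ⟨hconn, le_antisymm ?_ hconn.card_vert_le_card_edgeSet_add_one⟩
    have hsub : F.edgeSet ⊆ (fun x => s(x, R.parent x)) '' {x | x ≠ R.root} := by
      intro e
      induction e using Sym2.ind with
      | _ x y =>
        intro he
        have hxy : F.Adj x y := he
        rcases ((SimpleGraph.fromRel_adj _ _ _).1 hxy).2 with ⟨h1, h2⟩ | ⟨h1, h2⟩
        · exact ⟨x, h1, by simp [h2]⟩
        · exact ⟨y, h1, by simp [h2, Sym2.eq_swap]⟩
    have h1 : F.edgeSet.ncard ≤ {x | x ≠ R.root}.ncard :=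
      (Set.ncard_le_ncard hsub (Set.toFinite _)).trans (Set.ncard_image_le (Set.toFinite _))
    have h2 : {x | x ≠ R.root}.ncard + 1 = Nat.card τ := by
      have := Set.ncard_add_ncard_compl ({R.root} : Set τ)
      rw [Set.ncard_singleton] at this
      rw [← this, add_comm]
      rfl
    rw [Nat.card_coe_set_eq]
    omega
  refine ⟨τ, hτ, {
    tree := F
    isTree := htree
    bag := R.bag
    covers_edge := fun u w huw => R.covers u trivial w huw
    covers_vertex := fun v => ?_
    bags_connected := fun v => ?_ }, R.centred⟩
  · obtain ⟨x, hx, -⟩ := R.top v trivial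
    exact ⟨x, hx⟩
  · obtain ⟨s, hs, hs'⟩ := R.top v trivial
    rw [connected_iff_exists_forall_reachable]
    refine ⟨⟨s, hs⟩, ?_⟩
    rintro ⟨x, hx⟩
    induction hn : R.depth x using Nat.strong_induction_on generalizing x with
    | _ n ih =>
      by_cases hxs : x = s
      · subst hxs
        rfl
      · obtain ⟨hxr, hp⟩ := hs' x hx hxs
        have hd := R.depth_parent x hxr
        have hA : (F.induce {x | v ∈ R.bag x}).Adj ⟨R.parent x, hp⟩ ⟨x, hx⟩ :=
          (hadj x hxr).symm
        exact (ih _ (hn ▸ hd) _ hp rfl).trans hA.reachable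

end Tree

section Tower

variable {V : Type}

/-- No vertex of the sets `A j` with `j < i` is equal or adjacent to `v`. -/
def Far (G : SimpleGraph V) (A : ℕ → Set V) (i : ℕ) (v : V) : Prop :=
  ∀ j < i, ∀ a ∈ A j, ¬ Close G a v

theorem Far.mono {G : SimpleGraph V} {A : ℕ → Set V} {i j : ℕ} {v : V} (h : Far G A j v)
    (hij : i ≤ j) : Far G A i v := fun l hl => h l (hl.trans_le hij)

/-- A sequence of non-decomposable sets `C i`, each obtained from the previous one by deleting
the radius-two neighbourhood of a set `A i` of at most `K i` vertices, chosen to make `C (i + 1)`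
as small as possible subject to `A i` being far from the earlier sets. -/
structure Tower (G : SimpleGraph V) (m : ℕ) (K : ℕ → ℕ) (A C : ℕ → Set V) : Prop where
  zero : C 0 = Set.univ
  far : ∀ i, ∀ a ∈ A i, Far G A i a
  card_le : ∀ i, (A i).ncard ≤ K i
  subset : ∀ i, C (i + 1) ⊆ C i
  notMem : ∀ i, ∀ b ∈ C (i + 1), b ∉ relBall G (C i) (A i)
  boundary : ∀ i, ∀ u ∈ outerBoundary G (C (i + 1)), u ∈ C i → u ∈ relBall G (C i) (A i)
  not_decomposable : ∀ i, ¬ Decomposable G m (C i)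
  minimal : ∀ i (B D : Set V), (∀ a ∈ B, Far G A i a) → B.ncard ≤ K i → D ⊆ C i →
    (∀ b ∈ D, b ∉ relBall G (C i) B) →
    (∀ u ∈ outerBoundary G D, u ∈ C i → u ∈ relBall G (C i) B) →
    ¬ Decomposable G m D → (C (i + 1)).ncard ≤ D.ncard

theorem relBall_empty (G : SimpleGraph V) (C : Set V) : relBall G C ∅ = ∅ := by
  ext
  simp [relBall]

theorem relBall_mono {G : SimpleGraph V} {C C' A A' : Set V} (hC : C ⊆ C') (hA : A ⊆ A') :
    relBall G C A ⊆ relBall G C' A' := by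
  rintro b ⟨hb, a, ha, h⟩
  refine ⟨hC hb, a, hA ha, h.imp_right ?_⟩
  rintro ⟨c, hc, h⟩
  exact ⟨c, hC hc, h⟩

theorem exists_minimal_step (G : SimpleGraph V) (m n : ℕ) (P C : Set V)
    (hC : ¬ Decomposable G m C) :
    ∃ A D : Set V, ((∀ a ∈ A, ∀ p ∈ P, ¬ Close G p a) ∧ A.ncard ≤ n ∧ D ⊆ C ∧
      (∀ b ∈ D, b ∉ relBall G C A) ∧
      (∀ u ∈ outerBoundary G D, u ∈ C → u ∈ relBall G C A) ∧ ¬ Decomposable G m D) ∧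
      ∀ B E : Set V, (∀ a ∈ B, ∀ p ∈ P, ¬ Close G p a) → B.ncard ≤ n → E ⊆ C →
        (∀ b ∈ E, b ∉ relBall G C B) →
        (∀ u ∈ outerBoundary G E, u ∈ C → u ∈ relBall G C B) → ¬ Decomposable G m E →
        D.ncard ≤ E.ncard := by
  classical
  let good : Set V × Set V → Prop := fun q =>
    (∀ a ∈ q.1, ∀ p ∈ P, ¬ Close G p a) ∧ q.1.ncard ≤ n ∧ q.2 ⊆ C ∧
      (∀ b ∈ q.2, b ∉ relBall G C q.1) ∧
      (∀ u ∈ outerBoundary G q.2, u ∈ C → u ∈ relBall G C q.1) ∧ ¬ Decomposable G m q.2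
  have hne : ∃ l q, good q ∧ q.2.ncard = l :=
    ⟨_, (∅, C), ⟨by simp, by simp, subset_rfl, by simp [relBall_empty],
      fun u hu hu' => (hu.1 hu').elim, hC⟩, rfl⟩
  obtain ⟨⟨A, D⟩, hq, hl⟩ := Nat.find_spec hne
  refine ⟨A, D, hq, fun B E h1 h2 h3 h4 h5 h6 => ?_⟩
  have := Nat.find_min' hne ⟨(B, E), ⟨h1, h2, h3, h4, h5, h6⟩, rfl⟩
  exact hl.trans_le this

theorem exists_tower {G : SimpleGraph V} {m : ℕ} (h : ¬ Decomposable G m Set.univ) (K : ℕ → ℕ) :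
    ∃ A C, Tower G m K A C := by
  have hstep : ∀ (i : ℕ) (s : Set V × {C : Set V // ¬ Decomposable G m C}), _ := fun i s =>
    exists_minimal_step G m (K i) s.1 s.2.1 s.2.2
  choose fA fD hf hmin using hstep
  let s : ℕ → Set V × {C : Set V // ¬ Decomposable G m C} := fun n =>
    Nat.rec (∅, ⟨Set.univ, h⟩) (fun i q => (q.1 ∪ fA i q, ⟨fD i q, (hf i q).2.2.2.2.2⟩)) n
  have hs : ∀ i, s (i + 1) = ((s i).1 ∪ fA i (s i), ⟨fD i (s i), (hf i (s i)).2.2.2.2.2⟩) :=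
    fun i => rfl
  have hfar : ∀ i v, Far G (fun i => fA i (s i)) i v ↔ ∀ p ∈ (s i).1, ¬ Close G p v := by
    intro i v
    induction i with
    | zero => simp [Far, s]
    | succ i ih =>
      rw [hs]
      constructor
      · rintro h p (hp | hp)
        · exact ih.1 (h.mono i.le_succ) p hp
        · exact h i i.lt_succ_self p hp
      · intro h j hj a ha
        rcases Nat.lt_succ_iff_lt_or_eq.1 hj with hj | rfl
        · exact ih.2 (fun p hp => h p (Or.inl hp)) j hj a ha
        · exact h a (Or.inr ha)
  refine ⟨fun i => fA i (s i), fun i => (s i).2.1, rfl, ?_, ?_, ?_, ?_, ?_, ?_, ?_⟩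
  · exact fun i a ha => (hfar i a).2 ((hf i (s i)).1 a ha)
  · exact fun i => (hf i (s i)).2.1
  · exact fun i => (hf i (s i)).2.2.1
  · exact fun i => (hf i (s i)).2.2.2.1
  · exact fun i => (hf i (s i)).2.2.2.2.1
  · exact fun i => (s i).2.2
  · exact fun i B D h1 => hmin i (s i) B D fun a ha => (hfar i a).1 (h1 a ha)

namespace Tower

variable {G : SimpleGraph V} {m : ℕ} {K : ℕ → ℕ} {A C : ℕ → Set V}

theorem antitone (h : Tower G m K A C) : Antitone C := antitone_nat_of_succ_le h.subset

theorem not_close (h : Tower G m K A C) {i : ℕ} {a v : V} (ha : a ∈ A i) (hv : v ∈ C (i + 1)) :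
    ¬ Close G a v := fun hc => h.notMem i v hv ⟨h.subset i hv, a, ha, Or.inl hc⟩

theorem far_of_mem (h : Tower G m K A C) {i : ℕ} {v : V} (hv : v ∈ C i) : Far G A i v :=
  fun _ hj _ ha => h.not_close ha (h.antitone hj hv)

theorem exists_mem_relBall (h : Tower G m K A C) {n : ℕ} {u : V}
    (hu : u ∈ outerBoundary G (C n)) : ∃ j < n, u ∈ relBall G (C j) (A j) := by
  induction n with
  | zero => exact (hu.1 (h.zero ▸ trivial)).elim
  | succ n ih =>
    by_cases hun : u ∈ C n
    · exact ⟨n, n.lt_succ_self, h.boundary n u hu hun⟩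
    · obtain ⟨-, v, hv, hvu⟩ := hu
      obtain ⟨j, hj, hu⟩ := ih ⟨hun, v, h.subset n hv, hvu⟩
      exact ⟨j, hj.trans n.lt_succ_self, hu⟩

end Tower

/-- The boundary vertices of `C r` that are close to `A i` inside `C i`, but not to a later
`A j`. -/
def blocker (G : SimpleGraph V) (A C : ℕ → Set V) (r i : ℕ) : Set V :=
  {b | b ∈ relBall G (C i) (A i) ∧ b ∈ outerBoundary G (C r) ∧
    ∀ j, i < j → j < r → b ∉ relBall G (C i) (A j)}

/-- The vertices of `C i` adjacent to both `A i` and a blocker of level `i`. -/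
def middle (G : SimpleGraph V) (A C : ℕ → Set V) (r i : ℕ) : Set V :=
  {c | c ∈ C i ∧ (∃ a ∈ A i, G.Adj a c) ∧ ∃ b ∈ blocker G A C r i, G.Adj c b}

/-- The set `A i` together with the middle vertices of level `i`. -/
def core (G : SimpleGraph V) (A C : ℕ → Set V) (r i : ℕ) : Set V :=
  A i ∪ middle G A C r i

/-- The final set `C r` together with all cores and blockers. -/
def skeleton (G : SimpleGraph V) (A C : ℕ → Set V) (r : ℕ) : Set V :=
  C r ∪ {v | ∃ i < r, v ∈ core G A C r i ∪ blocker G A C r i}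

theorem Close.symm {G : SimpleGraph V} {u v : V} (h : Close G u v) : Close G v u :=
  h.imp Eq.symm Adj.symm

namespace Tower

variable {G : SimpleGraph V} {m : ℕ} {K : ℕ → ℕ} {A C : ℕ → Set V} {r : ℕ}

theorem not_close_core (h : Tower G m K A C) {i : ℕ} {x y : V} (hx : x ∈ core G A C r i)
    (hy : y ∈ C (i + 1)) : ¬ Close G x y := by
  rcases hx with hx | ⟨hxC, ⟨a, ha, hax⟩, -⟩
  · exact h.not_close hx hy
  · rintro (rfl | hxy)
    · exact h.not_close ha hy (Or.inr hax)
    · exact h.notMem i y hy ⟨h.subset i hy, a, ha, Or.inr ⟨x, hxC, hax, hxy⟩⟩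

theorem not_close_core_centre (h : Tower G m K A C) {i j : ℕ} (hij : i < j) (hj : j < r) {x a : V}
    (hx : x ∈ core G A C r i) (ha : a ∈ A j) : ¬ Close G x a := by
  rcases hx with hx | ⟨hxC, -, b, hb, hxb⟩
  · exact h.far j a ha i hij x hx
  · intro hxa
    refine hb.2.2 j hij hj ⟨hb.1.1, a, ha, ?_⟩
    rcases hxa with rfl | hxa
    · exact Or.inl (Or.inr hxb)
    · exact Or.inr ⟨x, hxC, hxa.symm, hxb⟩

theorem not_close_blocker_core (h : Tower G m K A C) {i j : ℕ} (hij : i < j) (hj : j < r)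
    {x y : V} (hx : x ∈ blocker G A C r i) (hy : y ∈ core G A C r j) : ¬ Close G x y := by
  intro hxy
  rcases hy with hy | ⟨hyC, ⟨a, ha, hay⟩, -⟩
  · exact hx.2.2 j hij hj ⟨hx.1.1, y, hy, Or.inl hxy.symm⟩
  · refine hx.2.2 j hij hj ⟨hx.1.1, a, ha, ?_⟩
    rcases hxy with rfl | hxy
    · exact Or.inl (Or.inr hay)
    · exact Or.inr ⟨y, h.antitone hij.le hyC, hay, hxy.symm⟩

theorem not_close_of_lt (h : Tower G m K A C) {i j : ℕ} (hij : i < j) (hj : j < r) {x y : V}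
    (hx : x ∈ core G A C r i) (hy : y ∈ core G A C r j ∪ blocker G A C r j) :
    ¬ Close G x y := by
  rcases hy with (hy | hy) | hy
  · exact h.not_close_core_centre hij hj hx hy
  · exact h.not_close_core hx (h.antitone hij hy.1)
  · exact h.not_close_core hx (h.antitone hij hy.1.1)

theorem eq_of_close (h : Tower G m K A C) {i j : ℕ} (hi : i < r) (hj : j < r) {x y : V}
    (hx : x ∈ core G A C r i) (hy : y ∈ core G A C r j ∪ blocker G A C r j)
    (hxy : Close G y x) : i = j := by
  rcases lt_trichotomy i j with hij | hij | hij
  · exact (h.not_close_of_lt hij hj hx hy hxy.symm).elim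
  · exact hij
  · rcases hy with hy | hy
    · exact (h.not_close_of_lt hij hi hy (Or.inl hx) hxy).elim
    · exact (h.not_close_blocker_core hij hi hy hx hxy).elim

theorem not_close_blocker (h : Tower G m K A C) {i : ℕ} (hi : i < r) {a b : V} (ha : a ∈ A i)
    (hb : b ∈ blocker G A C r i) : ¬ Close G a b := by
  obtain ⟨-, d, hd, hdb⟩ := hb.2.1
  have hd' : d ∈ C (i + 1) := h.antitone hi hd
  rintro (rfl | hab)
  · exact h.not_close ha hd' (Or.inr hdb.symm)
  · exact h.notMem i d hd' ⟨h.subset i hd', a, ha, Or.inr ⟨b, hb.1.1, hab, hdb.symm⟩⟩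

theorem far_of_close (h : Tower G m K A C) {i : ℕ} (hi : i < r) {x u : V}
    (hx : x ∈ skeleton G A C r) (hu : u ∈ C i) (hxu : Close G x u) : Far G A i x := by
  rcases hx with hx | ⟨l, hl, hx⟩
  · exact h.far_of_mem (h.antitone hi.le hx)
  · rcases lt_or_ge l i with hli | hli
    · rcases hx with hx | hx
      · exact (h.not_close_core hx (h.antitone hli hu) hxu).elim
      · intro j hj a ha hax
        rcases lt_trichotomy j l with hjl | rfl | hjl
        · exact h.far_of_mem hx.1.1 j hjl a ha hax
        · exact h.not_close_blocker hl ha hx hax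
        · exact hx.2.2 j hjl (hj.trans hi) ⟨hx.1.1, a, ha, Or.inl hax⟩
    · rcases hx with (hx | hx) | hx
      · exact (h.far l x hx).mono hli
      · exact h.far_of_mem (h.antitone hli hx.1)
      · exact h.far_of_mem (h.antitone hli hx.1.1)

end Tower

end Tower

section Live

variable {V : Type}

theorem ballAround_mono {G : SimpleGraph V} {S T : Set V} (h : S ⊆ T) (n : ℕ) :
    ballAround G S n ⊆ ballAround G T n := by
  rintro v ⟨u, hu, hv⟩
  exact ⟨u, h hu, hv⟩

theorem Close.edist_le_one {G : SimpleGraph V} {u v : V} (h : Close G u v) : G.edist u v ≤ 1 :=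
  SimpleGraph.edist_le_one_iff_adj_or_eq.2 (Or.symm h)

theorem closedNbhd_subset_ballAround (G : SimpleGraph V) (S : Set V) :
    closedNbhd G S ⊆ ballAround G S 2 := by
  rintro v ⟨u, hu, huv⟩
  exact ⟨u, hu, huv.edist_le_one.trans (by norm_num)⟩

theorem relBall_subset_ballAround (G : SimpleGraph V) (C A : Set V) :
    relBall G C A ⊆ ballAround G A 2 := by
  rintro b ⟨-, a, ha, hab | ⟨c, -, hac, hcb⟩⟩
  · exact ⟨a, ha, hab.edist_le_one.trans (by norm_num)⟩
  · refine ⟨a, ha, SimpleGraph.edist_triangle.trans ((add_le_add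
      (Close.edist_le_one (Or.inr hac)) (Close.edist_le_one (Or.inr hcb))).trans ?_)⟩
    norm_num

theorem ncard_biUnion_le_sum {A : ℕ → Set V} {K : ℕ → ℕ} (h : ∀ i, (A i).ncard ≤ K i)
    (s : Finset ℕ) : (⋃ j ∈ s, A j).ncard ≤ ∑ j ∈ s, K j := by
  classical
  induction s using Finset.induction_on with
  | empty => simp
  | insert a s ha ih =>
    rw [Finset.set_biUnion_insert, Finset.sum_insert ha]
    exact (Set.ncard_union_le _ _).trans (add_le_add (h a) ih)

/-- The vertices `a` of `A i` for which some vertex of the boundary of `E`, lying outside `X`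
and not close to any later `A j`, is close to `a` inside `C i`. -/
def live (G : SimpleGraph V) (A C : ℕ → Set V) (r i : ℕ) (X E : Set V) : Set V :=
  {a | a ∈ A i ∧ ∃ b ∈ relBall G (C i) {a}, b ∈ outerBoundary G E ∧ b ∉ X ∧
    ∀ j, i < j → j < r → b ∉ relBall G (C i) (A j)}

namespace Tower

variable {G : SimpleGraph V} {m : ℕ} {K : ℕ → ℕ} {A C : ℕ → Set V} {r : ℕ}

theorem isCentred_boundary_union (h : Tower G m K A C) {S : Set V}
    (hm : ∑ j ∈ Finset.range r, K j + S.ncard ≤ m) {Y : Set V}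
    (hY : Y ⊆ outerBoundary G (C r) ∪ closedNbhd G S ∪
      ballAround G ((⋃ j ∈ Finset.range r, A j) ∪ S) 2) :
    IsCentred G m 2 Y := by
  refine ⟨(⋃ j ∈ Finset.range r, A j) ∪ S, ?_, fun y hy => ?_⟩
  · exact (Set.ncard_union_le _ _).trans
      ((add_le_add (ncard_biUnion_le_sum h.card_le _) le_rfl).trans hm)
  · rcases hY hy with (hy | hy) | hy
    · obtain ⟨j, hj, hy⟩ := h.exists_mem_relBall hy
      refine ballAround_mono ?_ 2 (relBall_subset_ballAround _ _ _ hy)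
      intro a ha
      exact Or.inl (Set.mem_biUnion (Finset.mem_range.2 hj) ha)
    · exact ballAround_mono Set.subset_union_right 2 (closedNbhd_subset_ballAround _ _ hy)
    · exact hy

theorem lt_ncard_live [Finite V] (h : Tower G m K A C) {i : ℕ} (hi : i < r) {S E : Set V} {v : V}
    (hS : S ⊆ skeleton G A C r) (hv : v ∈ C r)
    (hm : ∑ j ∈ Finset.range r, K j + (insert v S).ncard ≤ m)
    (hE : E ⊆ C r \ closedNbhd G (insert v S)) (hbad : ¬ Decomposable G m E)
    (hbd : ∀ u ∈ outerBoundary G E, u ∈ C r → u ∈ closedNbhd G (insert v S)) :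
    K i < (live G A C r i (closedNbhd G (insert v S)) E).ncard +
      ∑ j ∈ Finset.Ico (i + 1) r, K j + (S.ncard + 1) := by
  by_contra! hle
  set X := closedNbhd G (insert v S) with hX
  let B : Set V := (live G A C r i X E ∪ ⋃ j ∈ Finset.Ico (i + 1) r, A j) ∪
    insert v (S ∩ {x | Far G A i x})
  have hBcard : B.ncard ≤ K i := by
    refine (Set.ncard_union_le _ _).trans (le_trans (add_le_add ?_ ?_) hle)
    · exact (Set.ncard_union_le _ _).trans
        (add_le_add le_rfl (ncard_biUnion_le_sum h.card_le _))
    · exact (Set.ncard_insert_le _ _).trans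
        (add_le_add (Set.ncard_le_ncard Set.inter_subset_left (Set.toFinite _)) le_rfl)
  have hvC : v ∈ C i := h.antitone hi.le hv
  have hBfar : ∀ a ∈ B, Far G A i a := by
    rintro a ((ha | ha) | rfl | ha)
    · exact h.far i a ha.1
    · simp only [Set.mem_iUnion] at ha
      obtain ⟨j, hj, ha⟩ := ha
      exact (h.far j a ha).mono (by have := Finset.mem_Ico.1 hj; omega)
    · exact h.far_of_mem hvC
    · exact ha.2
  have hlater : ∀ j, i < j → j < r → A j ⊆ B := fun j hij hj a ha =>
    Or.inl (Or.inr (Set.mem_biUnion (Finset.mem_Ico.2 ⟨hij, hj⟩) ha))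
  have hXB : ∀ u ∈ X, u ∈ C i → u ∈ relBall G (C i) B := by
    rintro u ⟨s, hs, hsu⟩ huC
    refine ⟨huC, s, ?_, Or.inl hsu⟩
    rcases hs with rfl | hs
    · exact Or.inr (Or.inl rfl)
    · exact Or.inr (Or.inr ⟨hs, h.far_of_close hi (hS hs) huC hsu⟩)
  have hbdE : ∀ u ∈ outerBoundary G E, u ∈ outerBoundary G (C r) ∨ u ∈ X := by
    intro u hu
    by_cases hur : u ∈ C r
    · exact Or.inr (hbd u hu hur)
    · obtain ⟨-, w, hw, hwu⟩ := hu
      exact Or.inl ⟨hur, w, (hE hw).1, hwu⟩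
  have hEB : ∀ u ∈ outerBoundary G E, u ∈ C i → u ∈ relBall G (C i) B := by
    intro u hu huC
    by_cases huX : u ∈ X
    · exact hXB u huX huC
    obtain ⟨j, hj, huj⟩ := h.exists_mem_relBall ((hbdE u hu).resolve_right huX)
    rcases lt_trichotomy j i with hji | rfl | hij
    · exact (h.notMem j u (h.antitone hji huC) huj).elim
    · by_cases hex : ∃ l, j < l ∧ l < r ∧ u ∈ relBall G (C j) (A l)
      · obtain ⟨l, hjl, hl, hul⟩ := hex
        exact relBall_mono subset_rfl (hlater l hjl hl) hul
      · push Not at hex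
        obtain ⟨-, a, ha, hau⟩ := huj
        refine ⟨huC, a, Or.inl (Or.inl ⟨ha, u, ⟨huC, a, rfl, hau⟩, hu, huX, hex⟩), hau⟩
    · exact relBall_mono (h.antitone hij.le) (hlater j hij hj) huj
  have hBsub : B ⊆ (⋃ j ∈ Finset.range r, A j) ∪ insert v S := by
    rintro a ((ha | ha) | ha | ha)
    · exact Or.inl (Set.mem_biUnion (Finset.mem_range.2 hi) ha.1)
    · simp only [Set.mem_iUnion] at ha
      obtain ⟨j, hj, ha⟩ := ha
      exact Or.inl (Set.mem_biUnion (Finset.mem_range.2 (Finset.mem_Ico.1 hj).2) ha)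
    · exact Or.inr (Or.inl ha)
    · exact Or.inr (Or.inr ha.1)
  have hcen : IsCentred G m 2 (outerBoundary G E ∪ E ∩ relBall G (C i) B) := by
    refine h.isCentred_boundary_union hm ?_
    rintro y (hy | hy)
    · exact Or.inl (hbdE y hy)
    · exact Or.inr (ballAround_mono hBsub 2 (relBall_subset_ballAround _ _ _ hy.2))
  obtain ⟨D, hD, hDbad, hDbd, -⟩ := exists_not_decomposable_component hbad hcen
  have hlt : E.ncard < (C r).ncard := by
    refine Set.ncard_lt_ncard ⟨fun x hx => (hE hx).1, fun hsub => ?_⟩ (Set.toFinite _)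
    exact (hE (hsub hv)).2 ⟨v, Set.mem_insert _ _, Or.inl rfl⟩
  have hmin := h.minimal i B D hBfar hBcard (fun x hx => h.antitone hi.le (hE (hD hx).1).1)
    (fun b hb => (hD hb).2) (fun u hu huC => ?_) hDbad
  · have h1 : D.ncard ≤ E.ncard :=
      Set.ncard_le_ncard (fun x hx => (hD hx).1) (Set.toFinite _)
    have h2 : (C r).ncard ≤ (C (i + 1)).ncard :=
      Set.ncard_le_ncard (h.antitone hi) (Set.toFinite _)
    omega
  · by_cases huE : u ∈ E
    · exact hDbd u hu huE
    · obtain ⟨-, w, hw, hwu⟩ := hu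
      exact hEB u ⟨huE, w, (hD hw).1, hwu⟩ huC

end Tower

end Live

section Separator

variable {V : Type}

theorem exists_separator_of_balancedSeparators [Finite V] {G : SimpleGraph V} {H : Set V} {k : ℕ}
    (hsep : AdmitsBalancedSeparators (G.induce H) k 1) (w : V → NNReal) :
    ∃ S ⊆ H, S.ncard ≤ k ∧ ∀ E ⊆ H, E.Nonempty → ConnectedOn G E →
      (∀ x ∈ E, x ∉ closedNbhd G S) → ∃ Q, E ⊆ Q ∧
        (∀ x ∈ Q, ∀ y ∈ H, y ∉ closedNbhd G S → G.Adj x y → y ∈ Q) ∧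
        ∑ᶠ x ∈ Q, w x ≤ (∑ᶠ x ∈ H, w x) / 2 := by
  obtain ⟨Z, ⟨T, hT, hZ⟩, hbal⟩ := hsep fun x => w x
  have hZ' : ∀ y (hy : y ∈ H), y ∉ closedNbhd G (Subtype.val '' T) → (⟨y, hy⟩ : H) ∈ Zᶜ := by
    intro y hy hyS hyZ
    obtain ⟨u, hu, huy⟩ := hZ hyZ
    refine hyS ⟨u, ⟨u, hu, rfl⟩, ?_⟩
    rcases SimpleGraph.edist_le_one_iff_adj_or_eq.1 (by simpa using huy) with h | h
    · exact Or.inr h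
    · exact Or.inl (congrArg Subtype.val h)
  refine ⟨Subtype.val '' T, ?_, (Set.ncard_image_le (Set.toFinite _)).trans hT, ?_⟩
  · rintro _ ⟨x, -, rfl⟩
    exact x.2
  · rintro E hEH ⟨e, he⟩ hconn hE
    let c := ((G.induce H).induce Zᶜ).connectedComponentMk ⟨⟨e, hEH he⟩, hZ' e _ (hE e he)⟩
    let f : ↥Zᶜ → V := fun x => x.1.1
    have hf : Function.Injective f := Subtype.val_injective.comp Subtype.val_injective
    have hclosed : ∀ x ∈ f '' c.supp, ∀ y ∈ H, y ∉ closedNbhd G (Subtype.val '' T) →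
        G.Adj x y → y ∈ f '' c.supp := by
      rintro _ ⟨x, hx, rfl⟩ y hyH hy hxy
      refine ⟨⟨⟨y, hyH⟩, hZ' y hyH hy⟩, ?_, rfl⟩
      rw [ConnectedComponent.mem_supp_iff] at hx ⊢
      rw [← hx]
      exact ConnectedComponent.connectedComponentMk_eq_of_adj hxy.symm
    refine ⟨f '' c.supp, ?_, hclosed, ?_⟩
    · refine hconn _ ⟨e, he, ⟨⟨e, hEH he⟩, hZ' e _ (hE e he)⟩, rfl, rfl⟩ fun x hx y hy hxy => ?_
      exact hclosed x hx.2 y (hEH hy) (hE y hy) hxy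
    · have hc := hbal c
      rw [finsum_mem_image hf.injOn]
      rwa [← finsum_set_coe_eq_finsum_mem H]

theorem finsum_mem_sum_indicator [Finite V] (A : ℕ → Set V) (c : ℕ → NNReal) (s : Finset ℕ)
    (Q : Set V) :
    ∑ᶠ x ∈ Q, ∑ i ∈ s, (A i).indicator (fun _ => c i) x =
      ∑ i ∈ s, ((A i ∩ Q).ncard : NNReal) * c i := by
  classical
  have := Fintype.ofFinite V
  rw [finsum_mem_eq_finite_toFinset_sum _ (Set.toFinite Q), Finset.sum_comm]
  refine Finset.sum_congr rfl fun i _ => ?_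
  have h : ∀ x, (A i).indicator (fun _ => c i) x = if x ∈ A i then c i else 0 := fun x => by
    simp [Set.indicator_apply]
  simp only [h]
  rw [← Finset.sum_filter, Finset.sum_const, nsmul_eq_mul,
    Set.ncard_eq_toFinset_card _ (Set.toFinite _)]
  congr 3
  ext x
  simp [and_comm]

theorem eight_mul_sum_add (c n i : ℕ) :
    8 * ∑ j ∈ Finset.Ico (i + 1) (i + 1 + n), c * 9 ^ (i + 1 + n - j) + 9 * c =
      c * 9 ^ (i + 1 + n - i) := by
  rw [Finset.sum_Ico_eq_sum_range]
  induction n with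
  | zero => simp [mul_comm]
  | succ n ih =>
    rw [show i + 1 + (n + 1) - (i + 1) = n + 1 by omega, Finset.sum_range_succ']
    rw [show i + 1 + n - (i + 1) = n by omega, show i + 1 + n - i = n + 1 by omega] at ih
    have : ∀ x, i + 1 + (n + 1) - (i + 1 + (x + 1)) = i + 1 + n - (i + 1 + x) := by omega
    simp only [this]
    rw [show i + 1 + (n + 1) - i = n + 1 + 1 by omega,
      show i + 1 + (n + 1) - (i + 1 + 0) = n + 1 by omega, mul_add, pow_succ 9 (n + 1)]
    linarith

end Separator

section Main

variable {V : Type}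

theorem nonempty_of_not_decomposable {G : SimpleGraph V} {m : ℕ} {C : Set V}
    (h : ¬ Decomposable G m C) : C.Nonempty := by
  rw [Set.nonempty_iff_ne_empty]
  rintro rfl
  exact h (decomposable_empty G m)

namespace Tower

variable {G : SimpleGraph V} {m : ℕ} {K : ℕ → ℕ} {A C : ℕ → Set V} {r : ℕ}

/-- Each vertex of the skeleton is close to the core of at most one level. -/
theorem card_touched_le [Finite V] (h : Tower G m K A C) {S : Set V}
    (hS : S ⊆ skeleton G A C r) {t : Finset ℕ}
    (ht : ∀ i ∈ t, i < r ∧ ∃ s ∈ S, ∃ x ∈ core G A C r i, Close G s x) : t.card ≤ S.ncard := by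
  classical
  choose hlt s hs x hx hsx using ht
  rw [Set.ncard_eq_toFinset_card S (Set.toFinite S), ← Finset.card_attach]
  refine Finset.card_le_card_of_injOn (fun i => s i.1 i.2) (fun i _ => by simpa using hs i.1 i.2) ?_
  rintro ⟨i, hi⟩ - ⟨j, hj⟩ - hij
  simp only at hij
  have hlevel : ∃ l, ∀ n (hn : n ∈ t), s n hn = s i hi → n = l := by
    rcases hS (hs i hi) with hd | ⟨l, hl, hd⟩
    · exact (h.not_close_core (hx i hi) (h.antitone (hlt i hi) hd) (hsx i hi).symm).elim
    · refine ⟨l, fun n hn hni => h.eq_of_close (hlt n hn) hl (hx n hn) hd ?_⟩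
      rw [← hni]
      exact hsx n hn
  obtain ⟨l, hl⟩ := hlevel
  exact Subtype.ext ((hl i hi rfl).trans (hl j hj hij.symm).symm)

theorem live_subset (h : Tower G m K A C) {i : ℕ} (hi : i < r) {S E X Q : Set V}
    (hSX : closedNbhd G S ⊆ X) (hE : E ⊆ C r)
    (hbd : ∀ u ∈ outerBoundary G E, u ∈ C r → u ∈ X) (hEQ : E ⊆ Q)
    (hQ : ∀ x ∈ Q, ∀ y ∈ skeleton G A C r, y ∉ closedNbhd G S → G.Adj x y → y ∈ Q)
    (hcore : ∀ s ∈ S, ∀ x ∈ core G A C r i, ¬ Close G s x) :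
    live G A C r i X E ⊆ A i ∩ Q := by
  rintro a ⟨ha, b, ⟨hbC, a', rfl, hab⟩, hbE, hbX, hlater⟩
  have hbr : b ∈ outerBoundary G (C r) := by
    refine ⟨fun hb => hbX (hbd b hbE hb), ?_⟩
    obtain ⟨-, d, hd, hdb⟩ := hbE
    exact ⟨d, hE hd, hdb⟩
  have hb : b ∈ blocker G A C r i := ⟨⟨hbC, a', ha, hab⟩, hbr, hlater⟩
  obtain ⟨c, hc, hac, hcb⟩ := hab.resolve_left (h.not_close_blocker hi ha hb)
  have hcm : c ∈ core G A C r i := Or.inr ⟨hc, ⟨a', ha, hac⟩, b, hb, hcb⟩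
  have hfree : ∀ x ∈ core G A C r i, x ∉ closedNbhd G S := by
    rintro x hx ⟨s, hs, hsx⟩
    exact hcore s hs x hx hsx
  obtain ⟨-, d, hd, hdb⟩ := hbE
  have hbQ : b ∈ Q :=
    hQ d (hEQ hd) b (Or.inr ⟨i, hi, Or.inr hb⟩) (fun hbS => hbX (hSX hbS)) hdb
  have hcQ : c ∈ Q := hQ b hbQ c (Or.inr ⟨i, hi, Or.inl hcm⟩) (hfree c hcm) hcb.symm
  exact ⟨ha, hQ c hcQ a' (Or.inr ⟨i, hi, Or.inl (Or.inl ha)⟩) (hfree a' (Or.inl ha)) hac.symm⟩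

end Tower

theorem decomposable_univ_of_balancedSeparators [Finite V] {G : SimpleGraph V} {k r : ℕ} {K : ℕ → ℕ}
    (hsep : ∀ A : Set V, AdmitsBalancedSeparators (G.induce A) k 1)
    (hr : r = 4 * k + 4) (hK : ∀ i, K i = (k + 1) * 9 ^ (r - i)) :
    Decomposable G (∑ j ∈ Finset.range r, K j + (k + 1)) Set.univ := by
  classical
  by_contra hbad
  obtain ⟨A, C, h⟩ := exists_tower hbad K
  obtain ⟨S, hS, hSk, hbal⟩ := exists_separator_of_balancedSeparators (hsep (skeleton G A C r))
    fun x => ∑ i ∈ Finset.range r, (A i).indicator (fun _ => (K i : NNReal)⁻¹) x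
  simp only [finsum_mem_sum_indicator] at hbal
  obtain ⟨v, hv⟩ := nonempty_of_not_decomposable (h.not_decomposable r)
  have hm : ∑ j ∈ Finset.range r, K j + (insert v S).ncard ≤
      ∑ j ∈ Finset.range r, K j + (k + 1) :=
    Nat.add_le_add_left ((Set.ncard_insert_le v S).trans (Nat.add_le_add_right hSk 1)) _
  have hSX : closedNbhd G S ⊆ closedNbhd G (insert v S) := by
    rintro x ⟨s, hs, hx⟩
    exact ⟨s, Or.inr hs, hx⟩
  obtain ⟨E, hE, hEbad, hEbd, hEconn⟩ := exists_not_decomposable_component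
    (X := closedNbhd G (insert v S)) (h.not_decomposable r)
    (h.isCentred_boundary_union hm (by
      rintro y (hy | hy)
      · exact Or.inl (Or.inl hy)
      · exact Or.inl (Or.inr hy.2)))
  obtain ⟨Q, hEQ, hQ, hle⟩ := hbal E (fun x hx => Or.inl (hE hx).1)
    (nonempty_of_not_decomposable hEbad) hEconn fun x hx hxS => (hE hx).2 (hSX hxS)
  have hKpos : ∀ i, (0 : NNReal) < K i := fun i => by
    rw [hK]
    positivity
  let U := (Finset.range r).filter fun i => ∀ s ∈ S, ∀ x ∈ core G A C r i, ¬ Close G s x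
  have hU : r ≤ U.card + k := by
    have h1 := Finset.card_filter_add_card_filter_not (s := Finset.range r)
      (fun i => ∀ s ∈ S, ∀ x ∈ core G A C r i, ¬ Close G s x)
    have h2 := h.card_touched_le hS (t := (Finset.range r).filter
      fun i => ¬ ∀ s ∈ S, ∀ x ∈ core G A C r i, ¬ Close G s x) fun i hi => by
        simp only [Finset.mem_filter, Finset.mem_range] at hi
        push Not at hi
        exact hi
    rw [Finset.card_range] at h1
    change U.card + _ = r at h1
    omega
  have hlarge : ∀ i ∈ U, (3 / 4 : NNReal) ≤ ((A i ∩ Q).ncard : NNReal) * (K i : NNReal)⁻¹ := by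
    intro i hi
    simp only [U, Finset.mem_filter, Finset.mem_range] at hi
    have h1 := h.lt_ncard_live hi.1 hS hv hm hE hEbad hEbd
    have h2 := Set.ncard_le_ncard
      (h.live_subset hi.1 hSX (fun x hx => (hE hx).1) hEbd hEQ hQ hi.2) (Set.toFinite _)
    have h3 := eight_mul_sum_add (k + 1) (r - (i + 1)) i
    rw [show i + 1 + (r - (i + 1)) = r by omega] at h3
    simp only [← hK] at h3
    have h4 : 3 * K i ≤ 4 * (A i ∩ Q).ncard := by omega
    rw [← div_eq_mul_inv, div_le_div_iff₀ (by norm_num) (hKpos i), mul_comm _ (4 : NNReal)]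
    exact_mod_cast h4
  have htotal : ∑ i ∈ Finset.range r,
      ((A i ∩ skeleton G A C r).ncard : NNReal) * (K i : NNReal)⁻¹ ≤ r := by
    calc _ ≤ ∑ i ∈ Finset.range r, (1 : NNReal) := Finset.sum_le_sum fun i _ => by
          rw [← div_eq_mul_inv, div_le_one (hKpos i)]
          exact_mod_cast (Set.ncard_le_ncard Set.inter_subset_left (Set.toFinite _)).trans
            (h.card_le i)
      _ = r := by simp
  have hpart : (U.card : NNReal) * (3 / 4) ≤ r / 2 := by
    calc (U.card : NNReal) * (3 / 4) = ∑ i ∈ U, (3 / 4 : NNReal) := by simp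
      _ ≤ ∑ i ∈ U, ((A i ∩ Q).ncard : NNReal) * (K i : NNReal)⁻¹ := Finset.sum_le_sum hlarge
      _ ≤ ∑ i ∈ Finset.range r, ((A i ∩ Q).ncard : NNReal) * (K i : NNReal)⁻¹ :=
        Finset.sum_le_sum_of_subset (Finset.filter_subset _ _)
      _ ≤ _ := hle
      _ ≤ _ := by gcongr
  have hnat : 3 * U.card ≤ 2 * r := by
    have : (3 * U.card : NNReal) ≤ 2 * r := by
      calc (3 * U.card : NNReal) = U.card * (3 / 4) * 4 := by ring
        _ ≤ r / 2 * 4 := by gcongr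
        _ = 2 * r := by ring
    exact_mod_cast this
  omega

end Main

/-- Main theorem: for all `k, t` there exists `k'` such that every `K_{t,t}`-free finite graph
all of whose induced subgraphs admit `(k, 1)`-balanced separators has a `(k', 2)`-centred
tree-decomposition. -/
theorem main_theorem (k t : ℕ) :
    ∃ k' : ℕ, ∀ (V : Type) (_ : Fintype V) (G : SimpleGraph V),
      IsEmpty (completeBipartiteGraph (Fin t) (Fin t) ↪g G) →
      (∀ A : Set V, AdmitsBalancedSeparators (G.induce A) k 1) →
      ∃ (τ : Type) (_ : Fintype τ) (D : TreeDecomp G τ),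
        ∀ x : τ, IsCentred G k' 2 (D.bag x) := by
  refine ⟨∑ j ∈ Finset.range (4 * k + 4), (k + 1) * 9 ^ (4 * k + 4 - j) + (k + 1),
    fun V _ G _ hsep => exists_treeDecomp_of_decomposable_univ ?_⟩
  exact decomposable_univ_of_balancedSeparators hsep rfl fun _ => rfl
end

section
/- For all k, t ∈ ℕ, there exist k', q ∈ ℕ such that every finite simple K_{t,t}-free graph G, all of whose induced subgraphs admit (k, 1)-balanced separators, is q-quasi-isometric to a graph with treewidth at most k'. -/
open SimpleGraph
open scoped ENNReal NNReal

/-- The vertices reachable from `v` by a path inside `S`. -/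
def compIn {V : Type*} (G : SimpleGraph V) (S : Set V) (v : V) : Set V :=
  {w | Relation.ReflTransGen (fun a b => G.Adj a b ∧ a ∈ S ∧ b ∈ S) v w}

/-- The closed neighbourhood of a set of vertices. -/
def clNbhd {V : Type*} (G : SimpleGraph V) (X : Set V) : Set V :=
  {v | ∃ u ∈ X, u = v ∨ G.Adj u v}

/-- Every independent set contained in `X` has at most `m` elements. -/
def IndepLE {V : Type*} (G : SimpleGraph V) (X : Set V) (m : ℕ) : Prop :=
  ∀ s : Finset V, ↑s ⊆ X → G.IsIndepSet (s : Set V) → s.card ≤ m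

theorem not_biclique {V ι κ : Type*} {G : SimpleGraph V} {t : ℕ}
    (h : IsEmpty (completeBipartiteGraph (Fin t) (Fin t) ↪g G))
    (X : Finset ι) (Y : Finset κ) (x : ι → V) (y : κ → V)
    (hX : t ≤ X.card) (hY : t ≤ Y.card)
    (hx : Set.InjOn x X) (hy : Set.InjOn y Y)
    (hxi : ∀ i ∈ X, ∀ j ∈ X, ¬ G.Adj (x i) (x j)) (hyi : ∀ i ∈ Y, ∀ j ∈ Y, ¬ G.Adj (y i) (y j))
    (hxy : ∀ i ∈ X, ∀ j ∈ Y, G.Adj (x i) (y j)) : False := by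
  obtain ⟨X', hX', hXc⟩ := Finset.exists_subset_card_eq hX
  obtain ⟨Y', hY', hYc⟩ := Finset.exists_subset_card_eq hY
  let e := (X'.equivFinOfCardEq hXc).symm
  let f := (Y'.equivFinOfCardEq hYc).symm
  refine h.elim ⟨⟨Sum.elim (fun i => x (e i)) (fun i => y (f i)), ?_⟩, ?_⟩
  · rintro (i | i) (j | j) hij
    · simp only [Sum.elim_inl] at hij
      have := hx (hX' (e i).2) (hX' (e j).2) hij
      simpa using this
    · simp only [Sum.elim_inl, Sum.elim_inr] at hij
      exact absurd (hij ▸ hxy _ (hX' (e i).2) _ (hY' (f j).2)) (G.irrefl)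
    · simp only [Sum.elim_inl, Sum.elim_inr] at hij
      exact absurd (hij ▸ hxy _ (hX' (e j).2) _ (hY' (f i).2)) (G.irrefl)
    · simp only [Sum.elim_inr] at hij
      have := hy (hY' (f i).2) (hY' (f j).2) hij
      simpa using this
  · rintro (i | i) (j | j)
    · exact iff_of_false (hxi _ (hX' (e i).2) _ (hX' (e j).2)) (by simp)
    · exact iff_of_true (hxy _ (hX' (e i).2) _ (hY' (f j).2)) (by simp)
    · exact iff_of_true (hxy _ (hX' (e j).2) _ (hY' (f i).2)).symm (by simp)
    · exact iff_of_false (hyi _ (hY' (f i).2) _ (hY' (f j).2)) (by simp)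

theorem exists_endHomogeneous (κ : Type*) [Fintype κ] [Nonempty κ] (m : ℕ) :
    ∃ R : ℕ, ∀ (α : Type) [LinearOrder α] (S : Finset α) (c : α → α → κ), R ≤ S.card →
      ∃ T ⊆ S, m ≤ T.card ∧ ∃ χ : α → κ, ∀ x ∈ T, ∀ y ∈ T, x < y → c x y = χ x := by
  classical
  induction m with
  | zero =>
    exact ⟨0, fun α _ S c _ => ⟨∅, by simp, by simp, fun _ => Classical.arbitrary κ, by simp⟩⟩
  | succ m ih =>
    obtain ⟨R, hR⟩ := ih
    refine ⟨Fintype.card κ * R + 1, fun α _ S c hS => ?_⟩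
    have hne : S.Nonempty := Finset.card_pos.mp (by omega)
    set a := S.min' hne with ha
    have haS : a ∈ S := S.min'_mem hne
    obtain ⟨k, -, hk⟩ := Finset.exists_le_card_fiber_of_mul_le_card_of_maps_to
      (s := S.erase a) (t := (Finset.univ : Finset κ)) (f := c a) (n := R) (by simp)
      Finset.univ_nonempty (by rw [Finset.card_erase_of_mem haS, Finset.card_univ]; omega)
    obtain ⟨T, hT, hTc, χ, hχ⟩ := hR α _ c hk
    have hTS : ∀ x ∈ T, x ∈ S ∧ x ≠ a ∧ c a x = k := fun x hx => by
      have := hT hx; simp at this; tauto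
    have hlt : ∀ x ∈ T, a < x := fun x hx =>
      lt_of_le_of_ne (S.min'_le _ (hTS x hx).1) (hTS x hx).2.1.symm
    have haT : a ∉ T := fun h => (hTS a h).2.1 rfl
    refine ⟨insert a T, ?_, ?_, Function.update χ a k, ?_⟩
    · intro x hx
      rcases Finset.mem_insert.mp hx with rfl | hx
      exacts [haS, (hTS x hx).1]
    · rw [Finset.card_insert_of_notMem haT]; omega
    · intro x hx y hy hxy
      rcases Finset.mem_insert.mp hx with rfl | hx
      · rcases Finset.mem_insert.mp hy with rfl | hy
        · exact absurd hxy (lt_irrefl _)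
        · simp [(hTS y hy).2.2]
      · rw [Function.update_of_ne (hTS x hx).2.1]
        rcases Finset.mem_insert.mp hy with rfl | hy
        · exact absurd hxy (not_lt.mpr (hlt x hx).le)
        · exact hχ x hx y hy hxy

theorem exists_homogeneous (κ : Type*) [Fintype κ] [Nonempty κ] (m : ℕ) :
    ∃ R : ℕ, ∀ (α : Type) [LinearOrder α] (S : Finset α) (c : α → α → κ), R ≤ S.card →
      ∃ T ⊆ S, m ≤ T.card ∧ ∃ χ : κ, ∀ x ∈ T, ∀ y ∈ T, x < y → c x y = χ := by
  classical
  obtain ⟨R, hR⟩ := exists_endHomogeneous κ (Fintype.card κ * m)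
  refine ⟨R, fun α _ S c hS => ?_⟩
  obtain ⟨T, hT, hTc, χ, hχ⟩ := hR α S c hS
  obtain ⟨k, -, hk⟩ := Finset.exists_le_card_fiber_of_mul_le_card_of_maps_to
      (s := T) (t := (Finset.univ : Finset κ)) (f := χ) (n := m) (by simp)
      Finset.univ_nonempty (by rw [Finset.card_univ]; omega)
  refine ⟨_, (Finset.filter_subset _ _).trans hT, hk, k, ?_⟩
  intro x hx y hy hxy
  simp only [Finset.mem_filter] at hx hy
  rw [hχ x hx.1 y hy.1 hxy, hx.2]

theorem exists_separator {V : Type*} [Fintype V] {G : SimpleGraph V} {A : Set V} {k : ℕ}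
    (h : AdmitsBalancedSeparators (G.induce A) k 1) (J : Finset V) (hJ : ↑J ⊆ A) :
    ∃ (T : Finset V) (S : Set V), T.card ≤ k ∧ ↑T ⊆ A ∧ S ⊆ A ∧ S ⊆ clNbhd G ↑T ∧
      ∀ v ∈ A \ S, ∀ J' ⊆ J, ↑J' ⊆ compIn G (A \ S) v → 2 * J'.card ≤ J.card := by
  classical
  obtain ⟨S, ⟨T, hT, hST⟩, hS⟩ := h (fun a => if (a : V) ∈ J then 1 else 0)
  refine ⟨(T.toFinset).map (Function.Embedding.subtype _), Subtype.val '' S, ?_, ?_, ?_, ?_, ?_⟩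
  · rwa [Finset.card_map, ← Set.ncard_eq_toFinset_card']
  · rintro _ h; simp at h; exact h.1
  · rintro _ ⟨x, -, rfl⟩; exact x.2
  · rintro _ ⟨x, hx, rfl⟩
    obtain ⟨u, hu, hux⟩ := hST hx
    refine ⟨u, by simpa using hu, ?_⟩
    have := edist_le_one_iff_adj_or_eq.mp (by simpa using hux)
    rcases this with h | h
    · exact Or.inr h
    · exact Or.inl (congrArg Subtype.val h)
  · intro v hv J' hJ' hcomp
    have hvS : (⟨v, hv.1⟩ : A) ∈ Sᶜ := fun hh => hv.2 ⟨_, hh, rfl⟩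
    set C := ((G.induce A).induce Sᶜ).connectedComponentMk ⟨⟨v, hv.1⟩, hvS⟩ with hC
    have hmem : ∀ w, w ∈ compIn G (A \ S.image Subtype.val) v →
        ∃ (h1 : w ∈ A) (h2 : (⟨w, h1⟩ : A) ∈ Sᶜ), (⟨⟨w, h1⟩, h2⟩ : ↥(Sᶜ)) ∈ C.supp := by
      intro w hw
      induction hw with
      | refl => exact ⟨hv.1, hvS, by simp [hC]⟩
      | @tail b c _ hbc ih =>
        obtain ⟨h1, h2, h3⟩ := ih
        have hc := hbc.2.2
        refine ⟨hc.1, fun hh => hc.2 ⟨_, hh, rfl⟩, ?_⟩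
        refine C.mem_supp_of_adj_mem_supp h3 ?_
        exact hbc.1
    have hsum := hS C
    rw [finsum_mem_eq_finite_toFinset_sum _ (Set.toFinite _), finsum_eq_sum_of_fintype] at hsum
    have h1 : (∑ v : A, if (v : V) ∈ J then (1 : NNReal) else 0) = J.card := by
      rw [Finset.sum_boole, Nat.cast_inj]
      refine Finset.card_bij (fun a _ => a.1) ?_ ?_ ?_
      · simp
      · intro a _ b _; exact Subtype.ext
      · intro b hb; exact ⟨⟨b, hJ hb⟩, by simpa using hb, rfl⟩
    have h2 : (J'.card : NNReal) ≤
        ∑ i ∈ (Set.toFinite C.supp).toFinset, if ((i : A) : V) ∈ J then (1 : NNReal) else 0 := by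
      rw [Finset.sum_boole, Nat.cast_le]
      choose h1 h2 h3 using hmem
      refine Finset.card_le_card_of_injOn
        (fun w => if hw : w ∈ J' then ⟨⟨w, h1 w (hcomp hw)⟩, h2 w (hcomp hw)⟩ else
          ⟨⟨v, hv.1⟩, hvS⟩) ?_ ?_
      · intro w hw
        have hw' : w ∈ J' := hw
        simp only [hw', dite_true]
        simpa [hJ' hw'] using h3 w (hcomp hw)
      · intro a ha b hb hab
        have ha' : a ∈ J' := ha
        have hb' : b ∈ J' := hb
        simpa [ha', hb'] using hab
    rw [h1] at hsum
    have := h2.trans hsum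
    rw [le_div_iff₀ (by norm_num)] at this
    have h3 : J'.card * 2 ≤ J.card := by exact_mod_cast this
    omega

theorem exists_homogeneous_fin (κ : Type*) [Fintype κ] [Nonempty κ] (m : ℕ) :
    ∃ R : ℕ, ∀ c : Fin R → Fin R → κ, ∃ f : Fin m → Fin R, StrictMono f ∧
      ∃ χ : κ, ∀ x y, x < y → c (f x) (f y) = χ := by
  obtain ⟨R, hR⟩ := exists_homogeneous κ m
  refine ⟨R, fun c => ?_⟩
  obtain ⟨T, -, hT, χ, hχ⟩ := hR (Fin R) Finset.univ c (by simp)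
  refine ⟨T.orderEmbOfCardLe hT, (T.orderEmbOfCardLe hT).strictMono, χ, fun x y hxy => ?_⟩
  exact hχ _ (T.orderEmbOfCardLe_mem hT x) _ (T.orderEmbOfCardLe_mem hT y)
    ((T.orderEmbOfCardLe hT).strictMono hxy)

/-- A subdivided-star configuration has no separator dominated by few vertices. -/
theorem not_starGadget {V : Type*} [Fintype V] {G : SimpleGraph V} {k : ℕ}
    (hsep : ∀ A : Set V, AdmitsBalancedSeparators (G.induce A) k 1)
    (d : Fin (2 * k + 1) → V) (Q : Fin (k + 1) → Option (Fin (2 * k + 1)) → V)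
    (hd : Function.Injective d) (hdi : ∀ j j', ¬ G.Adj (d j) (d j'))
    (hQd : ∀ i o j, G.Adj (Q i o) (d j) ↔ o = some j)
    (hQ : ∀ i j, G.Adj (Q i none) (Q i (some j)))
    (hne : ∀ i i', i ≠ i' → ∀ o o', Q i o ≠ Q i' o' ∧ ¬ G.Adj (Q i o) (Q i' o')) : False := by
  classical
  set A : Set V := Set.range d ∪ {v | ∃ i o, v = Q i o} with hA
  obtain ⟨T, S, hT, hTA, hSA, hST, hS⟩ := exists_separator (hsep A) (Finset.univ.image d)
    (by intro x hx; left; simpa using hx)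
  obtain ⟨i, hi⟩ : ∃ i, ∀ o, Q i o ∉ T := by
    by_contra! hcon
    choose o ho using hcon
    have := Finset.card_le_card_of_injOn (s := Finset.univ) (t := T) (fun i => Q i (o i))
      (fun i _ => ho i) (fun a _ b _ hab => by
        by_contra hab'
        exact (hne a b hab' _ _).1 hab)
    simp at this; omega
  set B : Finset (Fin (2 * k + 1)) := Finset.univ.filter fun j => d j ∈ clNbhd G (T : Set V) with hB
  have hBcard : B.card ≤ k := by
    refine le_trans ?_ hT
    have : ∀ j, ∃ t, j ∈ B → t ∈ T ∧ (t = d j ∨ G.Adj t (d j)) := by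
      intro j
      by_cases hj : j ∈ B
      · obtain ⟨t, ht, h⟩ := (Finset.mem_filter.mp hj).2
        exact ⟨t, fun _ => ⟨ht, h⟩⟩
      · exact ⟨d j, fun h => absurd h hj⟩
    choose τ hτ using this
    refine Finset.card_le_card_of_injOn τ (fun j hj => (hτ j hj).1) ?_
    intro a ha b hb hab
    obtain ⟨hTa, ha⟩ := hτ a ha
    obtain ⟨-, hb⟩ := hτ b hb
    rw [← hab] at hb
    rcases hTA hTa with ⟨j, hj⟩ | ⟨i, o, hio⟩
    · rw [← hj] at ha hb
      have h1 : j = a := hd (ha.resolve_right (hdi _ _))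
      have h2 : j = b := hd (hb.resolve_right (hdi _ _))
      exact h1.symm.trans h2
    · rcases ha with ha | ha
      · rw [ha] at hb
        exact hd (hb.resolve_right (hdi _ _))
      · rcases hb with hb | hb
        · rw [hb] at ha
          exact absurd ha (hdi _ _)
        · rw [hio, hQd] at ha hb
          exact Option.some_injective _ (ha.symm.trans hb)
  have hSN : ∀ v, v ∉ clNbhd G (T : Set V) → v ∉ S := fun v hv h => hv (hST h)
  have hdS : ∀ j ∉ B, d j ∉ S := fun j hj => hSN _ fun h => hj (by simpa [hB] using h)
  have hdT : ∀ j ∉ B, d j ∉ T := fun j hj h => hj (by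
    simp only [hB, Finset.mem_filter, Finset.mem_univ, true_and]; exact ⟨_, h, Or.inl rfl⟩)
  have hQS : ∀ o, (∀ j ∈ B, o ≠ some j) → Q i o ∉ S := by
    intro o ho
    refine hSN _ ?_
    rintro ⟨t, ht, htQ⟩
    rcases htQ with rfl | htQ
    · exact hi _ ht
    rcases hTA ht with ⟨j, rfl⟩ | ⟨i', o', rfl⟩
    · have := (hQd _ _ _).mp htQ.symm
      by_cases hj : j ∈ B
      · exact ho j hj this
      · exact hdT j hj ht
    · by_cases hii : i' = i
      · subst hii; exact hi _ ht
      · exact (hne _ _ hii _ _).2 htQ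
  have hdA : ∀ j, d j ∈ A := fun j => Or.inl ⟨j, rfl⟩
  have hQA : ∀ i o, Q i o ∈ A := fun i o => Or.inr ⟨i, o, rfl⟩
  have hc : Q i none ∈ A \ S := ⟨hQA _ _, hQS _ (by simp)⟩
  have := hS (Q i none) hc (Bᶜ.image d) (Finset.image_subset_image (Finset.subset_univ _)) (by
    intro x hx
    simp only [Finset.coe_image, Set.mem_image, Finset.mem_coe, Finset.mem_compl] at hx
    obtain ⟨j, hj, rfl⟩ := hx
    have h1 : Q i (some j) ∈ A \ S := ⟨hQA _ _, hQS _ (by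
      intro j' hj' h; cases h; exact hj hj')⟩
    exact (Relation.ReflTransGen.single ⟨hQ i j, hc, h1⟩).tail
      ⟨(hQd _ _ _).mpr rfl, h1, hdA j, hdS j hj⟩)
  rw [Finset.card_image_of_injective _ hd, Finset.card_image_of_injective _ hd,
    Finset.card_compl, Finset.card_univ, Fintype.card_fin] at this
  omega

theorem exists_not_gadget (k t : ℕ) : ∃ n M : ℕ, ∀ (V : Type) (_ : Fintype V) (G : SimpleGraph V),
    IsEmpty (completeBipartiteGraph (Fin t) (Fin t) ↪g G) →
    (∀ A : Set V, AdmitsBalancedSeparators (G.induce A) k 1) →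
    ∀ (d : Fin n → V) (Q : Fin M → Option (Fin n) → V),
      Function.Injective d → (∀ j j', ¬ G.Adj (d j) (d j')) →
      (∀ o, Function.Injective fun i => Q i o) → (∀ o i i', ¬ G.Adj (Q i o) (Q i' o)) →
      (∀ i j, G.Adj (Q i (some j)) (d j)) →
      (∀ i j, Q i (some j) = Q i none ∨ G.Adj (Q i (some j)) (Q i none)) → False := by
  classical
  obtain ⟨R, hR⟩ := exists_homogeneous_fin (Prop × Prop) (max (2 * k + 1) (t + 1))
  obtain ⟨M, hM⟩ := exists_homogeneous_fin
    ((Option (Fin (R + t)) → Option (Fin (R + t)) → Prop) ×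
      (Option (Fin (R + t)) → Fin (R + t) → Prop)) (max (2 * t) (k + 1) + 1)
  refine ⟨R + t, M, fun V _ G hfree hsep d Q hd hdi hQinj hQi hQd hQ => ?_⟩
  obtain ⟨f, hf, ⟨X, Y⟩, hXY⟩ := hM fun x y =>
    (fun o o' => G.Adj (Q x o) (Q y o'), fun o j => G.Adj (Q x o) (d j))
  have hX : ∀ x y, x < y → ∀ o o', G.Adj (Q (f x) o) (Q (f y) o') ↔ X o o' := by
    intro x y hxy o o'
    have := congrArg Prod.fst (hXY x y hxy)
    exact iff_of_eq (congrFun (congrFun this o) o')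
  have hXfalse : ∀ o o', ¬ X o o' := by
    intro o o' hXo
    refine not_biclique hfree (Finset.univ : Finset (Fin t)) (Finset.univ : Finset (Fin t))
      (fun i => Q (f ⟨i, by omega⟩) o) (fun i => Q (f ⟨t + i, by omega⟩) o') (by simp) (by simp)
      ?_ ?_ (fun _ _ _ _ => hQi _ _ _) (fun _ _ _ _ => hQi _ _ _) ?_
    · intro a _ b _ hab
      have := hf.injective (hQinj o hab)
      simpa [Fin.ext_iff] using this
    · intro a _ b _ hab
      have := hf.injective (hQinj o' hab)
      simpa [Fin.ext_iff] using this
    · intro a _ b _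
      refine (hX _ _ ?_ _ _).mpr hXo
      rw [Fin.lt_def]; simp only; omega
  have hcross : ∀ x y, x ≠ y → ∀ o o', ¬ G.Adj (Q (f x) o) (Q (f y) o') := by
    intro x y hxy o o' hadj
    rcases lt_or_gt_of_ne hxy with h | h
    · exact hXfalse _ _ ((hX _ _ h _ _).mp hadj)
    · exact hXfalse _ _ ((hX _ _ h _ _).mp hadj.symm)
  have hY : ∀ (x : Fin (max (2 * t) (k + 1))) o j, G.Adj (Q (f x.castSucc) o) (d j) ↔ Y o j := by
    intro x o j
    have := congrArg Prod.snd (hXY x.castSucc (Fin.last _) (Fin.castSucc_lt_last x))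
    exact iff_of_eq (congrFun (congrFun this o) j)
  have hYcard : ∀ o (P : Finset (Fin (R + t))), (∀ j ∈ P, Y o j) → P.card < t := by
    intro o P hP
    by_contra! hcon
    refine not_biclique hfree (Finset.univ : Finset (Fin (max (2 * t) (k + 1)))) P
      (fun x => Q (f x.castSucc) o) d (by simp; omega) hcon ?_ hd.injOn
      (fun _ _ _ _ => hQi _ _ _) (fun _ _ _ _ => hdi _ _) (fun x _ j hj => (hY x o j).mpr (hP j hj))
    intro a _ b _ hab
    exact Fin.castSucc_injective _ (hf.injective (hQinj o hab))
  set P : Finset (Fin (R + t)) := Finset.univ.filter fun j => Y none j with hP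
  have hPc : R ≤ Pᶜ.card := by
    have := hYcard none P (by simp [hP])
    rw [Finset.card_compl, Fintype.card_fin]; omega
  obtain ⟨f', hf', ⟨χ₁, χ₂⟩, hχ⟩ := hR fun a b =>
    (Y (some (Pᶜ.orderEmbOfCardLe hPc a)) (Pᶜ.orderEmbOfCardLe hPc b),
      Y (some (Pᶜ.orderEmbOfCardLe hPc b)) (Pᶜ.orderEmbOfCardLe hPc a))
  set g : Fin (max (2 * k + 1) (t + 1)) → Fin (R + t) :=
    fun a => Pᶜ.orderEmbOfCardLe hPc (f' a) with hg
  have hginj : Function.Injective g :=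
    (Pᶜ.orderEmbOfCardLe hPc).injective.comp hf'.injective
  have hgP : ∀ a, ¬ Y none (g a) := by
    intro a
    have := Pᶜ.orderEmbOfCardLe_mem hPc (f' a)
    exact fun h => (Finset.mem_compl.mp this) (Finset.mem_filter.mpr ⟨Finset.mem_univ _, h⟩)
  have h1 : ∀ a b, a < b → (Y (some (g a)) (g b) ↔ χ₁) := fun a b hab =>
    iff_of_eq (congrArg Prod.fst (hχ a b hab))
  have h2 : ∀ a b, a < b → (Y (some (g b)) (g a) ↔ χ₂) := fun a b hab =>
    iff_of_eq (congrArg Prod.snd (hχ a b hab))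
  have hχ₁ : ¬ χ₁ := by
    intro h
    have := hYcard (some (g ⟨0, by omega⟩))
      ((Finset.univ : Finset (Fin t)).image fun j : Fin t => g ⟨j + 1, by omega⟩) (by
        intro j hj
        simp only [Finset.mem_image, Finset.mem_univ, true_and] at hj
        obtain ⟨b, rfl⟩ := hj
        exact (h1 _ _ (by rw [Fin.lt_def]; simp)).mpr h)
    rw [Finset.card_image_of_injective] at this
    · simp at this
    · intro a b hab
      simpa [Fin.ext_iff] using hginj hab
  have hχ₂ : ¬ χ₂ := by
    intro h
    have := hYcard (some (g ⟨t, by omega⟩))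
      ((Finset.univ : Finset (Fin t)).image fun j : Fin t => g ⟨j, by omega⟩) (by
        intro j hj
        simp only [Finset.mem_image, Finset.mem_univ, true_and] at hj
        obtain ⟨b, rfl⟩ := hj
        exact (h2 _ _ (by rw [Fin.lt_def]; simp)).mpr h)
    rw [Finset.card_image_of_injective] at this
    · simp at this
    · intro a b hab
      simpa [Fin.ext_iff] using hginj hab
  have m1 : k + 1 ≤ max (2 * t) (k + 1) := le_max_right _ _
  have m2 : 2 * k + 1 ≤ max (2 * k + 1) (t + 1) := le_max_left _ _
  have x0 : Fin (max (2 * t) (k + 1)) := ⟨0, by omega⟩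
  have hYg : ∀ a b, Y (some (g a)) (g b) ↔ a = b := by
    intro a b
    constructor
    · intro h
      by_contra hab
      rcases lt_or_gt_of_ne hab with h' | h'
      · exact hχ₁ ((h1 _ _ h').mp h)
      · exact hχ₂ ((h2 _ _ h').mp h)
    · rintro rfl
      exact (hY x0 _ _).mp (hQd _ _)
  have hQadj : ∀ (x : Fin (max (2 * t) (k + 1))) a,
      G.Adj (Q (f x.castSucc) (some (g a))) (Q (f x.castSucc) none) := by
    intro x a
    refine (hQ _ _).resolve_left fun h => hgP a ?_
    rw [← hY x, ← h]
    exact hQd _ _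
  refine not_starGadget hsep (fun j => d (g (Fin.castLE m2 j)))
    (fun i o => Q (f (Fin.castLE m1 i).castSucc) (o.map fun j => g (Fin.castLE m2 j)))
    (fun a b hab => by simpa using hginj (hd hab)) (fun _ _ => hdi _ _) ?_ ?_ ?_
  · intro i o j
    rw [hY]
    rcases o with _ | o
    · simpa using hgP _
    · simpa using (hYg (Fin.castLE m2 o) (Fin.castLE m2 j)).trans (Fin.castLE_injective m2).eq_iff
  · intro i j
    exact (hQadj _ _).symm
  · intro i i' hii o o'
    have hff : (Fin.castLE m1 i).castSucc ≠ (Fin.castLE m1 i').castSucc := by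
      simpa [Fin.ext_iff] using hii
    refine ⟨?_, hcross _ _ hff _ _⟩
    intro heq
    rcases o with _ | o
    · rcases o' with _ | o'
      · exact hff (hf.injective (hQinj none heq))
      · have := hQadj (Fin.castLE m1 i') (Fin.castLE m2 o')
        simp only [Option.map] at heq
        rw [← heq] at this
        exact hcross _ _ hff _ _ this
    · have := hQadj (Fin.castLE m1 i) (Fin.castLE m2 o)
      simp only [Option.map] at heq
      rw [heq] at this
      exact hcross _ _ hff.symm _ _ this

theorem exists_max_indep {V : Type*} [Fintype V] (G : SimpleGraph V) (U : Set V) :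
    ∃ I : Finset V, ↑I ⊆ U ∧ G.IsIndepSet (I : Set V) ∧ IndepLE G U I.card := by
  classical
  obtain ⟨I, hI, hmax⟩ := Finset.exists_max_image
    (Finset.univ.filter fun s : Finset V => ↑s ⊆ U ∧ G.IsIndepSet (s : Set V)) Finset.card
    ⟨∅, by simp [IsIndepSet]⟩
  simp only [Finset.mem_filter, Finset.mem_univ, true_and] at hI hmax
  exact ⟨I, hI.1, hI.2, fun s h1 h2 => hmax s ⟨h1, h2⟩⟩

theorem IndepLE.mono {V : Type*} {G : SimpleGraph V} {U U' : Set V} {m m' : ℕ}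
    (h : IndepLE G U m) (hU : U' ⊆ U) (hm : m ≤ m') : IndepLE G U' m' :=
  fun s h1 h2 => (h s (h1.trans hU) h2).trans hm

theorem IndepLE.union {V : Type*} {G : SimpleGraph V} {U U' : Set V} {m m' : ℕ}
    (h : IndepLE G U m) (h' : IndepLE G U' m') : IndepLE G (U ∪ U') (m + m') := by
  classical
  intro s hs hi
  rw [← Finset.card_filter_add_card_filter_not (s := s) (· ∈ U)]
  refine add_le_add (h _ ?_ (hi.mono ?_)) (h' _ ?_ (hi.mono ?_))
  · intro x hx; simp at hx; exact hx.2
  · intro x hx; simp at hx; exact hx.1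
  · intro x hx; simp at hx; exact (hs hx.1).resolve_left hx.2
  · intro x hx; simp at hx; exact hx.1

theorem IndepLE.of_finset {V : Type*} {G : SimpleGraph V} (X : Finset V) :
    IndepLE G X X.card := fun _ hs _ => Finset.card_le_card (by exact_mod_cast hs)

theorem exists_matching_into_max_indep {V : Type*} [Fintype V] {G : SimpleGraph V} {U : Set V}
    {I : Finset V} (hIU : ↑I ⊆ U) (hI : G.IsIndepSet (I : Set V)) (hmax : IndepLE G U I.card)
    {X : Finset V} (hXU : ↑X ⊆ U) (hX : G.IsIndepSet (X : Set V)) :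
    ∃ π : V → V, Set.InjOn π X ∧ ∀ q ∈ X, π q ∈ I ∧ (q = π q ∨ G.Adj q (π q)) := by
  classical
  obtain ⟨f, hf, hft⟩ := (Finset.all_card_le_biUnion_card_iff_exists_injective
    (fun x : X => I.filter fun i => (x : V) = i ∨ G.Adj x i)).mp (by
      intro s
      set s' : Finset V := s.map (Function.Embedding.subtype _) with hs'
      set B := s.biUnion fun x : X => I.filter fun i => (x : V) = i ∨ G.Adj x i with hB
      have hsX : ∀ x ∈ s', x ∈ X := by simp +contextual [hs']
      have hBmem : ∀ x ∈ s', ∀ i ∈ I, (x = i ∨ G.Adj x i) → i ∈ B := by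
        intro x hx i hi h
        simp only [hs', Finset.mem_map, Function.Embedding.subtype_apply] at hx
        obtain ⟨y, hy, rfl⟩ := hx
        exact Finset.mem_biUnion.mpr ⟨y, hy, Finset.mem_filter.mpr ⟨hi, h⟩⟩
      have hBI : B ⊆ I := by
        intro i hi
        obtain ⟨x, -, hx⟩ := Finset.mem_biUnion.mp hi
        exact (Finset.mem_filter.mp hx).1
      have hdis : Disjoint (I \ B) s' := by
        rw [Finset.disjoint_left]
        intro i hi his
        rw [Finset.mem_sdiff] at hi
        exact hi.2 (hBmem i his i hi.1 (Or.inl rfl))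
      have hle := hmax ((I \ B) ∪ s') (by
        intro x hx
        simp only [Finset.coe_union, Set.mem_union, Finset.mem_coe, Finset.mem_sdiff] at hx
        rcases hx with hx | hx
        · exact hIU hx.1
        · exact hXU (hsX x hx)) (by
        intro x hx y hy hxy hadj
        simp only [Finset.coe_union, Set.mem_union, Finset.mem_coe, Finset.mem_sdiff] at hx hy
        rcases hx with hx | hx <;> rcases hy with hy | hy
        · exact hI hx.1 hy.1 hxy hadj
        · exact hx.2 (hBmem y hy x hx.1 (Or.inr hadj.symm))
        · exact hy.2 (hBmem x hx y hy.1 (Or.inr hadj))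
        · exact hX (hsX x hx) (hsX y hy) hxy hadj)
      rw [Finset.card_union_of_disjoint hdis, Finset.card_sdiff_of_subset hBI, hs',
        Finset.card_map] at hle
      have := Finset.card_le_card hBI
      omega)
  refine ⟨fun v => if h : v ∈ X then f ⟨v, h⟩ else v, ?_, ?_⟩
  · intro a ha b hb hab
    have ha' : a ∈ X := ha
    have hb' : b ∈ X := hb
    simp only [ha', hb', dite_true] at hab
    simpa using hf hab
  · intro q hq
    simpa [hq] using hft ⟨q, hq⟩

theorem exists_hub_bound (k t L : ℕ) : ∃ N e₀ : ℕ, ∀ e, e₀ ≤ e →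
    ∀ (V : Type) (_ : Fintype V) (G : SimpleGraph V),
    IsEmpty (completeBipartiteGraph (Fin t) (Fin t) ↪g G) →
    (∀ A : Set V, AdmitsBalancedSeparators (G.induce A) k 1) →
    ∀ U : Set V, IndepLE G U (L * e) →
      IndepLE G {d | ∃ s : Finset V, ↑s ⊆ U ∩ clNbhd G {d} ∧ G.IsIndepSet (s : Set V) ∧
        e ≤ s.card} N := by
  classical
  obtain ⟨n, M, hnM⟩ := exists_not_gadget k t
  refine ⟨2 * L * n, max 2 (2 ^ (2 * L * n + 1) * 2 * (M + 1)), ?_⟩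
  intro e he V _ G hfree hsep U hU D hD hDi
  by_contra! hcard
  set N := 2 * L * n + 1 with hN
  obtain ⟨D', hD'D, hD'c⟩ := Finset.exists_subset_card_eq (n := N) (s := D) (by omega)
  let d : Fin N → V := fun j => (D'.equivFinOfCardEq hD'c).symm j
  have hdinj : Function.Injective d :=
    Subtype.val_injective.comp (D'.equivFinOfCardEq hD'c).symm.injective
  have hdD : ∀ j, d j ∈ D := fun j => hD'D ((D'.equivFinOfCardEq hD'c).symm j).2
  have hdi : ∀ j j', ¬ G.Adj (d j) (d j') := by
    intro j j' h
    exact hDi (hdD j) (hdD j') h.ne h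
  choose s hsU hsi hse using fun j => hD (hdD j)
  have he2 : 2 ≤ e := (le_max_left _ _).trans he
  have hds : ∀ j, ∀ q ∈ s j, G.Adj q (d j) := by
    intro j q hq
    have hcl : ∀ q ∈ s j, d j = q ∨ G.Adj (d j) q := by
      intro q hq
      obtain ⟨u, hu, h⟩ := (hsU j hq).2
      rw [Set.mem_singleton_iff] at hu
      rwa [hu] at h
    rcases hcl q hq with h | h
    · exfalso
      obtain ⟨q', hq', hne⟩ := Finset.exists_mem_ne (lt_of_lt_of_le (by omega) (hse j)) q
      rcases hcl q' hq' with h' | h'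
      · exact hne (h'.symm.trans h)
      · rw [h] at h'
        exact hsi j hq hq' hne.symm h'
    · exact h.symm
  obtain ⟨I, hIU, hI, hmax⟩ := exists_max_indep G U
  have hIe : I.card ≤ L * e := hU I hIU hI
  choose π hπinj hπ using fun j => exists_matching_into_max_indep hIU hI hmax
    ((hsU j).trans Set.inter_subset_left) (hsi j)
  let r : V → Finset (Fin N) := fun i => Finset.univ.filter fun j => i ∈ (s j).image (π j)
  have hsum : N * e ≤ ∑ i ∈ I, (r i).card := by
    have h1 : ∑ i ∈ I, (r i).card = ∑ j : Fin N, (I.filter fun i => i ∈ (s j).image (π j)).card :=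
      Finset.sum_card_bipartiteAbove_eq_sum_card_bipartiteBelow
        (s := I) (t := (Finset.univ : Finset (Fin N))) (fun i j => i ∈ (s j).image (π j))
    rw [h1]
    have h2 : ∀ j, e ≤ (I.filter fun i => i ∈ (s j).image (π j)).card := by
      intro j
      refine (hse j).trans ?_
      rw [← Finset.card_image_of_injOn (hπinj j)]
      refine Finset.card_le_card fun i hi => Finset.mem_filter.mpr ⟨?_, hi⟩
      obtain ⟨q, hq, rfl⟩ := Finset.mem_image.mp hi
      exact (hπ j q hq).1
    calc N * e = ∑ _j : Fin N, e := by simp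
      _ ≤ _ := Finset.sum_le_sum fun j _ => h2 j
  set I' := I.filter fun i => n ≤ (r i).card with hI'
  have hle : ∑ i ∈ I, (r i).card ≤ I'.card * N + I.card * n := by
    calc ∑ i ∈ I, (r i).card ≤ ∑ i ∈ I, ((if n ≤ (r i).card then N else 0) + n) := by
          refine Finset.sum_le_sum fun i _ => ?_
          split_ifs with h
          · exact (Finset.card_le_univ _).trans (by simp)
          · omega
      _ = I'.card * N + I.card * n := by
          rw [Finset.sum_add_distrib, ← Finset.sum_filter]
          simp [hI']
  have hI'e : e ≤ 2 * I'.card := by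
    have h3 : I.card * n ≤ L * e * n := Nat.mul_le_mul_right _ hIe
    have h4 : 2 * (L * e * n) ≤ N * e := by
      rw [hN]; nlinarith
    have h5 : N * e ≤ N * (2 * I'.card) := by nlinarith
    exact Nat.le_of_mul_le_mul_left h5 (by omega)
  obtain ⟨P, -, hP⟩ := Finset.exists_le_card_fiber_of_mul_le_card_of_maps_to
    (s := I') (t := (Finset.univ : Finset (Finset (Fin N)))) (f := r) (n := M + 1) (by simp)
    Finset.univ_nonempty (by
      have := (le_max_right _ _).trans he
      rw [Finset.card_univ, Fintype.card_finset, Fintype.card_fin]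
      have h6 : 2 ^ N * 2 * (M + 1) = 2 * (2 ^ N * (M + 1)) := by ring
      omega)
  set F := I'.filter fun i => r i = P with hF
  have hFmem : ∀ i ∈ F, i ∈ I ∧ n ≤ (r i).card ∧ r i = P := by
    intro i hi
    simp only [hF, hI', Finset.mem_filter] at hi
    exact ⟨hi.1.1, hi.1.2, hi.2⟩
  have hPn : n ≤ P.card := by
    obtain ⟨i, hi⟩ := Finset.card_pos.mp (show 0 < F.card by omega)
    obtain ⟨-, h, h'⟩ := hFmem i hi
    rwa [h'] at h
  obtain ⟨F', hF', hF'c⟩ := Finset.exists_subset_card_eq (n := M) (s := F) (by omega)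
  let c : Fin M → V := fun j => (F'.equivFinOfCardEq hF'c).symm j
  have hcinj : Function.Injective c :=
    Subtype.val_injective.comp (F'.equivFinOfCardEq hF'c).symm.injective
  have hcF : ∀ i, c i ∈ F := fun i => hF' ((F'.equivFinOfCardEq hF'c).symm i).2
  let h : Fin n → Fin N := P.orderEmbOfCardLe hPn
  have hinj : Function.Injective h := (P.orderEmbOfCardLe hPn).injective
  have hhP : ∀ j, h j ∈ P := P.orderEmbOfCardLe_mem hPn
  have hq : ∀ i j, ∃ q, q ∈ s (h j) ∧ π (h j) q = c i := by
    intro i j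
    have h1 : h j ∈ r (c i) := by rw [(hFmem _ (hcF i)).2.2]; exact hhP j
    have h2 := (Finset.mem_filter.mp h1).2
    obtain ⟨q, hq, h3⟩ := Finset.mem_image.mp h2
    exact ⟨q, hq, h3⟩
  choose q hqs hqπ using hq
  refine hnM V ‹_› G hfree hsep (fun j => d (h j))
    (fun i o => match o with | none => c i | some j => q i j)
    (hdinj.comp hinj) (fun _ _ => hdi _ _) ?_ ?_ ?_ ?_
  · rintro (_ | j)
    · exact hcinj
    · intro a b hab
      have hab' : q a j = q b j := hab
      exact hcinj (by rw [← hqπ a j, ← hqπ b j, hab'])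
  · rintro (_ | j) i i' hadj
    · exact hI (hFmem _ (hcF i)).1 (hFmem _ (hcF i')).1 hadj.ne hadj
    · exact hsi _ (hqs i j) (hqs i' j) hadj.ne hadj
  · intro i j
    exact hds _ _ (hqs i j)
  · intro i j
    have := (hπ _ _ (hqs i j)).2
    rwa [hqπ] at this

section compIn

variable {V : Type*} {G : SimpleGraph V} {S S' : Set V} {v w : V}

theorem mem_compIn_self (G : SimpleGraph V) (S : Set V) (v : V) : v ∈ compIn G S v :=
  Relation.ReflTransGen.refl

theorem compIn_mono (h : S ⊆ S') : compIn G S v ⊆ compIn G S' v := by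
  intro w hw
  induction hw with
  | refl => exact Relation.ReflTransGen.refl
  | tail _ hab ih => exact Relation.ReflTransGen.tail ih ⟨hab.1, h hab.2.1, h hab.2.2⟩

theorem compIn_subset (hv : v ∈ S) : compIn G S v ⊆ S := by
  intro w hw
  induction hw with
  | refl => exact hv
  | tail _ h _ => exact h.2.2

theorem mem_compIn_of_adj {x : V} (hv : v ∈ S) (hw : w ∈ compIn G S v) (hadj : G.Adj w x)
    (hx : x ∈ S) : x ∈ compIn G S v :=
  Relation.ReflTransGen.tail hw ⟨hadj, compIn_subset hv hw, hx⟩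

theorem compIn_eq (hw : w ∈ compIn G S v) : compIn G S w = compIn G S v := by
  have : Std.Symm fun a b => G.Adj a b ∧ a ∈ S ∧ b ∈ S :=
    ⟨fun _ _ hab => ⟨hab.1.symm, hab.2.2, hab.2.1⟩⟩
  have hsymm : v ∈ compIn G S w := Relation.ReflTransGen.stdSymm.symm _ _ hw
  ext x
  exact ⟨fun hx => Relation.ReflTransGen.trans hw hx, fun hx => Relation.ReflTransGen.trans hsymm hx⟩

theorem clNbhd_mono {X Y : Set V} (h : X ⊆ Y) : clNbhd G X ⊆ clNbhd G Y :=
  fun _ ⟨u, hu, h'⟩ => ⟨u, h hu, h'⟩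

theorem subset_clNbhd {X : Set V} : X ⊆ clNbhd G X := fun u hu => ⟨u, hu, Or.inl rfl⟩

end compIn

/-- The bag of `v` for the layering `f` of `C`: the vertices in the layer of `v` in its component
of the part of `C` on or above that layer, and the neighbours of that component. -/
def layerBag {V : Type*} (G : SimpleGraph V) (C : Set V) (f : V → ℕ) (v : V) : Set V :=
  {u | (u ∈ compIn G {w | w ∈ C ∧ f v ≤ f w} v ∧ f u = f v) ∨
    (u ∉ compIn G {w | w ∈ C ∧ f v ≤ f w} v ∧
      ∃ w ∈ compIn G {w | w ∈ C ∧ f v ≤ f w} v, G.Adj w u)}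

theorem exists_boundary_step (k t : ℕ) : ∃ m p : ℕ, ∀ (V : Type) (_ : Fintype V)
    (G : SimpleGraph V), IsEmpty (completeBipartiteGraph (Fin t) (Fin t) ↪g G) →
    (∀ A : Set V, AdmitsBalancedSeparators (G.induce A) k 1) →
    ∀ (C U : Set V) (c : V), (∀ w ∈ C, ∀ u ∉ C, G.Adj w u → u ∈ clNbhd G U) → IndepLE G U m →
      ∃ W : Set V, c ∈ W ∧ IndepLE G W p ∧ ∀ v ∈ C \ clNbhd G W,
        ∃ U' : Set V, IndepLE G U' m ∧ ∀ w ∈ compIn G (C \ clNbhd G W) v,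
          ∀ u ∉ compIn G (C \ clNbhd G W) v, G.Adj w u → u ∈ clNbhd G U' := by
  classical
  obtain ⟨N, e₀, hN⟩ := exists_hub_bound k t (8 * (k + 1))
  set e := max (max e₀ (N + k + 1)) 1 with he
  refine ⟨8 * (k + 1) * e, N + k + 1, fun V _ G hfree hsep C U c hC hU => ?_⟩
  have hD := hN e (by omega) V ‹_› G hfree hsep U hU
  set D := {d | ∃ s : Finset V, ↑s ⊆ U ∩ clNbhd G {d} ∧ G.IsIndepSet (s : Set V) ∧
        e ≤ s.card} with hDdef
  obtain ⟨J, hJU, hJi, hJmax⟩ := exists_max_indep G (U \ D)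
  obtain ⟨T, S, hTk, hTD, hSD, hST, hS⟩ := exists_separator (hsep Dᶜ) J (fun x hx => (hJU hx).2)
  have hUS : IndepLE G (U ∩ S) (k * e) := by
    intro s hs hi
    have hsub : s ⊆ T.biUnion fun x => s.filter (· ∈ clNbhd G {x}) := by
      intro y hy
      obtain ⟨x, hx, hxy⟩ := hST (hs hy).2
      exact Finset.mem_biUnion.mpr ⟨x, hx, Finset.mem_filter.mpr ⟨hy, x, rfl, hxy⟩⟩
    refine (Finset.card_le_card hsub).trans ((Finset.card_biUnion_le_card_mul _ _ e ?_).trans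
      (Nat.mul_le_mul_right _ hTk))
    intro x hx
    by_contra! hcon
    refine hTD hx ⟨_, ?_, hi.mono (Finset.coe_subset.mpr (Finset.filter_subset _ _)), hcon.le⟩
    intro y hy
    simp only [Finset.coe_filter, Set.mem_ofPred_eq] at hy
    exact ⟨(hs hy.1).1, hy.2⟩
  set W : Set V := (D ∪ T) ∪ ({c} : Finset V) with hW
  have hWp : IndepLE G W (N + k + 1) :=
    (hD.union ((IndepLE.of_finset T).mono le_rfl hTk)).union (IndepLE.of_finset {c})
  have hDW : D ⊆ W := fun x hx => Or.inl (Or.inl hx)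
  have hSW : S ⊆ clNbhd G W := hST.trans (clNbhd_mono fun x hx => Or.inl (Or.inr hx))
  refine ⟨W, Or.inr (by simp), hWp, fun v hv => ?_⟩
  have hsub : C \ clNbhd G W ⊆ Dᶜ \ S := fun x hx =>
    ⟨fun h => hx.2 (subset_clNbhd (hDW h)), fun h => hx.2 (hSW h)⟩
  set K := compIn G (Dᶜ \ S) v with hK
  have hKm : IndepLE G ((U ∩ K) \ D) (4 * (k + 1) * e + k * e) := by
    intro s hs hi
    have h1 := hJmax ((J.filter fun x => x ∉ K ∧ x ∉ S) ∪ s) (by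
      intro x hx
      simp only [Finset.coe_union, Finset.coe_filter, Set.mem_union, Set.mem_ofPred_eq] at hx
      rcases hx with hx | hx
      · exact hJU hx.1
      · exact ⟨(hs hx).1.1, (hs hx).2⟩) (by
      have key : ∀ x ∈ J, x ∉ K ∧ x ∉ S → ∀ y ∈ s, ¬ G.Adj y x := by
        intro x hx hxK y hy hadj
        exact hxK.1 (mem_compIn_of_adj (hsub hv) (hs hy).1.2 hadj ⟨(hJU hx).2, hxK.2⟩)
      intro x hx y hy hxy hadj
      simp only [Finset.coe_union, Finset.coe_filter, Set.mem_union, Set.mem_ofPred_eq] at hx hy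
      rcases hx with hx | hx <;> rcases hy with hy | hy
      · exact hJi hx.1 hy.1 hxy hadj
      · exact key x hx.1 hx.2 y hy hadj.symm
      · exact key y hy.1 hy.2 x hx hadj
      · exact hi hx hy hxy hadj)
    rw [Finset.card_union_of_disjoint (by
      rw [Finset.disjoint_left]
      intro x hx hxs
      exact (Finset.mem_filter.mp hx).2.1 (hs hxs).1.2)] at h1
    have h2 : 2 * (J.filter (· ∈ K)).card ≤ J.card := hS v (hsub hv) _ (Finset.filter_subset _ _)
      (fun x hx => by simp at hx; exact hx.2)
    have h3 : (J.filter (· ∈ S)).card ≤ k * e := by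
      refine hUS _ ?_ (hJi.mono (Finset.coe_subset.mpr (Finset.filter_subset _ _)))
      intro x hx
      simp only [Finset.coe_filter, Set.mem_ofPred_eq] at hx
      exact ⟨(hJU hx.1).1, hx.2⟩
    have h4 : J.card ≤ 8 * (k + 1) * e :=
      (hU.mono Set.sdiff_subset le_rfl) J hJU hJi
    have h5 : J.card ≤ (J.filter fun x => x ∉ K ∧ x ∉ S).card +
        ((J.filter (· ∈ K)).card + (J.filter (· ∈ S)).card) := by
      refine le_trans (Finset.card_le_card ?_) ((Finset.card_union_le _ _).trans
        (Nat.add_le_add_left (Finset.card_union_le _ _) _))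
      intro x hx
      simp only [Finset.mem_union, Finset.mem_filter]
      tauto
    have h6 : 8 * (k + 1) * e = 2 * (4 * (k + 1) * e) := by ring
    omega
  refine ⟨((U ∩ K) \ D ∪ U ∩ S) ∪ W, (((hKm.union hUS).union hWp).mono le_rfl ?_), ?_⟩
  · have h1 : N + k + 1 ≤ e := by omega
    nlinarith
  · intro w hw b hb hadj
    by_cases hbW : b ∈ clNbhd G W
    · exact clNbhd_mono Set.subset_union_right hbW
    have hwC := compIn_subset hv hw
    have hbC : b ∉ C := fun h => hb (mem_compIn_of_adj hv hw hadj ⟨h, hbW⟩)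
    have hbD : b ∈ Dᶜ \ S := ⟨fun h => hbW (subset_clNbhd (hDW h)), fun h => hbW (hSW h)⟩
    obtain ⟨u, hu, hub⟩ := hC w hwC.1 b hbC hadj
    refine ⟨u, Or.inl ?_, hub⟩
    have huD : u ∉ D := fun h => hbW ⟨u, hDW h, hub⟩
    by_cases huS : u ∈ S
    · exact Or.inr ⟨hu, huS⟩
    refine Or.inl ⟨⟨hu, ?_⟩, huD⟩
    have hbK : b ∈ K := mem_compIn_of_adj (hsub hv) (compIn_mono hsub hw) hadj hbD
    rcases hub with rfl | hub
    · exact hbK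
    · exact mem_compIn_of_adj (hsub hv) hbK hub.symm ⟨huD, huS⟩

theorem exists_layering (k t : ℕ) : ∃ p : ℕ, ∀ (V : Type) (_ : Fintype V)
    (G : SimpleGraph V), IsEmpty (completeBipartiteGraph (Fin t) (Fin t) ↪g G) →
    (∀ A : Set V, AdmitsBalancedSeparators (G.induce A) k 1) →
    ∃ f : V → ℕ, ∀ v, ∃ X : Set V, IndepLE G X p ∧ layerBag G Set.univ f v ⊆ clNbhd G X := by
  classical
  obtain ⟨m, p, hstep⟩ := exists_boundary_step k t
  refine ⟨m + p, fun V _ G hfree hsep => ?_⟩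
  suffices H : ∀ (n : ℕ) (C U : Set V), C.ncard < n →
      (∀ w ∈ C, ∀ u ∉ C, G.Adj w u → u ∈ clNbhd G U) → IndepLE G U m →
      ∃ f : V → ℕ, ∀ v ∈ C, ∃ X : Set V, IndepLE G X (m + p) ∧ layerBag G C f v ⊆ clNbhd G X by
    obtain ⟨f, hf⟩ := H _ Set.univ ∅ (Nat.lt_succ_self _) (by simp) (by
      intro s hs _
      have : s = ∅ := by simpa using hs
      simp [this])
    exact ⟨f, fun v => hf v (Set.mem_univ v)⟩
  intro n
  induction n with
  | zero => intro C U h; omega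
  | succ n ih =>
    intro C U hn hC hU
    rcases C.eq_empty_or_nonempty with rfl | ⟨c, hc⟩
    · exact ⟨fun _ => 0, by simp⟩
    obtain ⟨W, hcW, hWp, hW⟩ := hstep V ‹_› G hfree hsep C U c hC hU
    set R := C \ clNbhd G W with hR
    have hRC : R.ncard < C.ncard := Set.ncard_lt_ncard
      ⟨Set.sdiff_subset, fun h => (h hc).2 (subset_clNbhd hcW)⟩ (Set.toFinite _)
    have hF : ∀ K : Set V, ∃ F : V → ℕ, (∃ v ∈ R, K = compIn G R v) →
        ∀ v ∈ K, ∃ X : Set V, IndepLE G X (m + p) ∧ layerBag G K F v ⊆ clNbhd G X := by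
      intro K
      by_cases hK : ∃ v ∈ R, K = compIn G R v
      · obtain ⟨v, hv, rfl⟩ := hK
        obtain ⟨U', hU', hb⟩ := hW v hv
        obtain ⟨F, hF⟩ := ih (compIn G R v) U'
          (lt_of_le_of_lt (Set.ncard_le_ncard (compIn_subset hv) (Set.toFinite _)) (by omega))
          hb hU'
        exact ⟨F, fun _ => hF⟩
      · exact ⟨fun _ => 0, fun h => absurd h hK⟩
    choose F hF using hF
    set f : V → ℕ := fun u => if u ∈ clNbhd G W then 0 else F (compIn G R u) u + 1 with hf
    refine ⟨f, fun v hv => ?_⟩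
    by_cases hvW : v ∈ clNbhd G W
    · refine ⟨U ∪ W, hU.union hWp, ?_⟩
      have hfv : f v = 0 := by simp [hf, hvW]
      rintro u (⟨-, hu⟩ | ⟨hu, w, hw, hadj⟩)
      · rw [hfv] at hu
        refine clNbhd_mono Set.subset_union_right ?_
        by_contra hcon
        simp [hf, hcon] at hu
      · refine clNbhd_mono Set.subset_union_left ?_
        have hvS : v ∈ {w | w ∈ C ∧ f v ≤ f w} := ⟨hv, le_rfl⟩
        exact hC w (compIn_subset hvS hw).1 u
          (fun huC => hu (mem_compIn_of_adj hvS hw hadj ⟨huC, by omega⟩)) hadj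
    · have hvR : v ∈ R := ⟨hv, hvW⟩
      obtain ⟨X, hX, hb⟩ := hF _ ⟨v, hvR, rfl⟩ v (mem_compIn_self G R v)
      refine ⟨X, hX, ?_⟩
      set K := compIn G R v with hK
      have hfK : ∀ w ∈ K, f w = F K w + 1 := by
        intro w hw
        have := (compIn_subset hvR hw).2
        simp only [hf, this, if_false]
        rw [compIn_eq hw]
      have hvK : v ∈ K := mem_compIn_self G R v
      have hvS : v ∈ {w | w ∈ K ∧ F K v ≤ F K w} := ⟨hvK, le_rfl⟩
      have hcomp : compIn G {w | w ∈ C ∧ f v ≤ f w} v =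
          compIn G {w | w ∈ K ∧ F K v ≤ F K w} v := by
        apply Set.Subset.antisymm
        · intro w hw
          induction hw with
          | refl => exact mem_compIn_self _ _ _
          | @tail b x _ hbx hb =>
            have hbK := (compIn_subset hvS hb).1
            obtain ⟨hadj, -, hxC, hx⟩ := hbx
            have hxW : x ∉ clNbhd G W := by
              intro h
              rw [hfK v hvK] at hx
              simp [hf, h] at hx
            have hxK : x ∈ K := mem_compIn_of_adj hvR hbK hadj ⟨hxC, hxW⟩
            refine mem_compIn_of_adj hvS hb hadj ⟨hxK, ?_⟩
            rw [hfK v hvK, hfK x hxK] at hx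
            omega
        · refine compIn_mono fun w hw => ⟨(compIn_subset hvR hw.1).1, ?_⟩
          rw [hfK v hvK, hfK w hw.1]
          exact Nat.add_le_add_right hw.2 1
      refine Set.Subset.trans ?_ hb
      intro u hu
      unfold layerBag at hu ⊢
      rw [hcomp] at hu
      rcases hu with ⟨hu, h⟩ | hu
      · refine Or.inl ⟨hu, ?_⟩
        rw [hfK v hvK, hfK u (compIn_subset hvS hu).1] at h
        omega
      · exact Or.inr hu

/-- An elimination structure: a rank on the vertices, a bag of earlier vertices for each vertex,
and a parent function making the bags into a tree-decomposition. -/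
structure ElimStruct {V : Type*} (G : SimpleGraph V) where
  rank : V → ℕ
  bag : V → Set V
  par : V → Option V
  mem_self : ∀ v, v ∈ bag v
  rank_lt : ∀ {u v}, u ∈ bag v → u ≠ v → rank u < rank v
  covers : ∀ {u v}, G.Adj u v → u ∈ bag v ∨ v ∈ bag u
  rank_par : ∀ {v p}, par v = some p → rank p < rank v
  bag_par : ∀ {u v p}, par v = some p → u ∈ bag v → u ≠ v → u ∈ bag p
  bag_none : ∀ {u v}, par v = none → u ∈ bag v → u = v

theorem exists_elimStruct_of_layering {V : Type*} [Fintype V] (G : SimpleGraph V) (f : V → ℕ) :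
    ∃ E : ElimStruct G, ∀ v, E.bag v ⊆ layerBag G Set.univ f v := by
  classical
  let n := Fintype.card V
  let ix := Fintype.equivFin V
  let g : V → ℕ := fun v => f v * n + ix v
  have hfg : ∀ {v w}, g v ≤ g w → f v ≤ f w := by
    intro v w h
    by_contra! hcon
    have h1 : (f w + 1) * n ≤ f v * n := Nat.mul_le_mul_right _ hcon
    have h2 : ((ix w : Fin _) : ℕ) < n := (ix w).2
    simp only [g] at h
    rw [Nat.add_mul] at h1
    omega
  have hg : ∀ {v w}, v ≠ w → g v ≠ g w := by
    intro v w hne h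
    have h1 : f v = f w := le_antisymm (hfg h.le) (hfg h.ge)
    simp only [g, h1] at h
    exact hne (ix.injective (Fin.ext (by omega)))
  let Cp : V → Set V := fun v => compIn G {w | g v ≤ g w} v
  let nb : V → Set V := fun v => {u | u ∉ Cp v ∧ ∃ w ∈ Cp v, G.Adj w u}
  have hCp : ∀ v, ∀ w ∈ Cp v, g v ≤ g w := fun v w hw =>
    compIn_subset (S := {w | g v ≤ g w}) (show g v ≤ g v from le_rfl) hw
  have hnb : ∀ v, ∀ u ∈ nb v, g u < g v := by
    rintro v u ⟨hu, w, hw, hadj⟩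
    by_contra! hcon
    exact hu (mem_compIn_of_adj (show g v ≤ g v from le_rfl) hw hadj hcon)
  have hpar : ∀ v, ∃ o : Option V, (∀ p, o = some p → p ∈ nb v ∧ ∀ u ∈ nb v, g u ≤ g p) ∧
      (o = none → nb v = ∅) := by
    intro v
    rcases (nb v).eq_empty_or_nonempty with h | h
    · exact ⟨none, by simp [h]⟩
    · obtain ⟨p, hp, hmax⟩ := Set.exists_max_image (nb v) g (Set.toFinite _) h
      refine ⟨some p, ?_, by simp⟩
      rintro _ ⟨⟩
      exact ⟨hp, hmax⟩
  choose par hpar hparn using hpar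
  refine ⟨⟨g, fun v => insert v (nb v), par, fun v => Set.mem_insert _ _, ?_, ?_, ?_, ?_, ?_⟩, ?_⟩
  · intro u v hu hne
    exact hnb v u (hu.resolve_left hne)
  · have key : ∀ u v, G.Adj u v → g u < g v → u ∈ nb v := fun u v hadj hlt =>
      ⟨fun h => absurd (hCp v u h) (by omega), v, mem_compIn_self _ _ _, hadj.symm⟩
    intro u v hadj
    rcases lt_or_gt_of_ne (hg hadj.ne) with h | h
    · exact Or.inl (Or.inr (key u v hadj h))
    · exact Or.inr (Or.inr (key v u hadj.symm h))
  · intro v p hp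
    exact hnb v p (hpar v p hp).1
  · intro u v p hp hu hne
    obtain ⟨hu, w, hw, hadj⟩ := hu.resolve_left hne
    obtain ⟨hpnb, hmax⟩ := hpar v p hp
    have hpv := hnb v p hpnb
    obtain ⟨hp', w₀, hw₀, hadj₀⟩ := hpnb
    rcases eq_or_ne u p with rfl | hup
    · exact Set.mem_insert _ _
    have hlt : g u < g p := lt_of_le_of_ne (hmax u ⟨hu, w, hw, hadj⟩) (hg hup)
    refine Or.inr ⟨fun h => absurd (hCp p u h) (by omega), w, ?_, hadj⟩
    have h1 : w₀ ∈ Cp p := mem_compIn_of_adj (show g p ≤ g p from le_rfl)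
      (mem_compIn_self _ _ _) hadj₀.symm (show g p ≤ g w₀ from hpv.le.trans (hCp v w₀ hw₀))
    have h2 : w ∈ compIn G {w | g v ≤ g w} w₀ := by rw [compIn_eq hw₀]; exact hw
    have h3 : w ∈ compIn G {w | g p ≤ g w} w₀ :=
      compIn_mono (fun x (hx : g v ≤ g x) => (show g p ≤ g x from hpv.le.trans hx)) h2
    rwa [compIn_eq h1] at h3
  · intro u v hv hu
    rcases hu with hu | hu
    · exact hu
    · rw [hparn v hv] at hu
      exact absurd hu (Set.notMem_empty _)
  · intro v
    have hsub : Cp v ⊆ compIn G {w | w ∈ Set.univ ∧ f v ≤ f w} v :=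
      compIn_mono fun w hw => ⟨Set.mem_univ _, hfg hw⟩
    intro u hu
    rcases hu with rfl | hu
    · exact Or.inl ⟨mem_compIn_self _ _ _, rfl⟩
    · have hlt := hnb v u hu
      obtain ⟨hu, w, hw, hadj⟩ := hu
      by_cases h : u ∈ compIn G {w | w ∈ Set.univ ∧ f v ≤ f w} v
      · refine Or.inl ⟨h, le_antisymm (hfg hlt.le) ?_⟩
        exact (compIn_subset (S := {w | w ∈ Set.univ ∧ f v ≤ f w}) ⟨Set.mem_univ v, le_rfl⟩ h).2
      · exact Or.inr ⟨h, w, hsub hw, hadj⟩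

theorem exists_coloring_of_subset_clNbhd {V : Type*} [Fintype V] {G : SimpleGraph V} {X B : Set V}
    {p : ℕ} (hX : IndepLE G X p) (hB : B ⊆ clNbhd G X) :
    ∃ col : V → V, (col '' B).ncard ≤ p ∧
      ∀ u ∈ B, ∀ w ∈ B, col u = col w → G.edist u w ≤ 4 := by
  classical
  obtain ⟨I, hIX, hI, hmax⟩ := exists_max_indep G X
  have hcl : ∀ u, (u ∈ B → ∃ i ∈ I, G.edist u i ≤ 2) := by
    intro u hu
    obtain ⟨x, hx, hxu⟩ := hB hu
    have h1 : G.edist u x ≤ 1 := by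
      rw [edist_le_one_iff_adj_or_eq]
      rcases hxu with h | h
      exacts [Or.inr h.symm, Or.inl h.symm]
    obtain ⟨i, hi, hxi⟩ : ∃ i ∈ I, G.edist x i ≤ 1 := by
      by_contra! hcon
      simp only [← not_le, edist_le_one_iff_adj_or_eq, not_or] at hcon
      have hxI : x ∉ I := fun h => (hcon x h).2 rfl
      have := hmax (insert x I) (by
        intro y hy
        rcases Finset.mem_insert.mp hy with rfl | hy
        exacts [hx, hIX hy]) (by
        intro y hy z hz hyz hadj
        rcases Finset.mem_insert.mp hy with rfl | hyI <;> rcases Finset.mem_insert.mp hz with rfl | hzI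
        · exact hyz rfl
        · exact (hcon z hzI).1 hadj
        · exact (hcon y hyI).1 hadj.symm
        · exact hI hyI hzI hyz hadj)
      rw [Finset.card_insert_of_notMem hxI] at this
      omega
    refine ⟨i, hi, (G.edist_triangle (v := x)).trans ((add_le_add h1 hxi).trans (by norm_num))⟩
  have : ∀ u, ∃ i, u ∈ B → i ∈ I ∧ G.edist u i ≤ 2 := by
    intro u
    by_cases hu : u ∈ B
    · obtain ⟨i, h⟩ := hcl u hu
      exact ⟨i, fun _ => h⟩
    · exact ⟨u, fun h => absurd h hu⟩
  choose col hcol using this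
  refine ⟨col, ?_, ?_⟩
  · refine le_trans ?_ (hX I hIX hI)
    rw [← Set.ncard_coe_finset I]
    refine Set.ncard_le_ncard ?_ (Set.toFinite _)
    rintro _ ⟨u, hu, rfl⟩
    exact (hcol u hu).1
  · intro u hu w hw h
    refine (G.edist_triangle (v := col u)).trans
      ((add_le_add (hcol u hu).2 ?_).trans (show (2 : ℕ∞) + 2 ≤ 4 by norm_num))
    rw [h, SimpleGraph.edist_comm]
    exact (hcol w hw).2

theorem exists_elimStruct (k t : ℕ) : ∃ p : ℕ, ∀ (V : Type) (_ : Fintype V)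
    (G : SimpleGraph V), IsEmpty (completeBipartiteGraph (Fin t) (Fin t) ↪g G) →
    (∀ A : Set V, AdmitsBalancedSeparators (G.induce A) k 1) →
    ∃ E : ElimStruct G, ∀ v, ∃ col : V → V, (col '' E.bag v).ncard ≤ p ∧
      ∀ u ∈ E.bag v, ∀ w ∈ E.bag v, col u = col w → G.edist u w ≤ 4 := by
  obtain ⟨p, hp⟩ := exists_layering k t
  refine ⟨p, fun V _ G hfree hsep => ?_⟩
  obtain ⟨f, hf⟩ := hp V ‹_› G hfree hsep
  obtain ⟨E, hE⟩ := exists_elimStruct_of_layering G f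
  refine ⟨E, fun v => ?_⟩
  obtain ⟨X, hX, hb⟩ := hf v
  exact exists_coloring_of_subset_clNbhd hX ((hE v).trans hb)

open Classical in
/-- The anchor of `v` inherits the anchor of the parent as long as the bag of `v` meets, within
`A`, the bag of that anchor. -/
noncomputable def ElimStruct.anchor {V : Type*} {G : SimpleGraph V} (E : ElimStruct G) (A : Set V)
    (v : V) : V :=
  match _h : E.par v with
  | none => v
  | some p => if (E.bag v ∩ E.bag (E.anchor A p) ∩ A).Nonempty then E.anchor A p else v
termination_by E.rank v
decreasing_by all_goals exact E.rank_par ‹_›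

namespace ElimStruct

variable {V : Type*} {G : SimpleGraph V} (E : ElimStruct G) (A : Set V)

theorem anchor_none {v : V} (h : E.par v = none) : E.anchor A v = v := by
  unfold anchor
  split
  · rfl
  · simp_all

theorem anchor_some {v p : V} (h : E.par v = some p) :
    ((E.bag v ∩ E.bag (E.anchor A p) ∩ A).Nonempty ∧ E.anchor A v = E.anchor A p) ∨
    (¬ (E.bag v ∩ E.bag (E.anchor A p) ∩ A).Nonempty ∧ E.anchor A v = v) := by
  rw [anchor.eq_def E A v]
  split
  · simp_all
  · rename_i q hq
    obtain rfl : p = q := by simpa [h] using hq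
    by_cases hne : (E.bag v ∩ E.bag (E.anchor A p) ∩ A).Nonempty
    · exact Or.inl ⟨hne, if_pos hne⟩
    · exact Or.inr ⟨hne, if_neg hne⟩

theorem nonempty_of_anchor_ne {v : V} (h : E.anchor A v ≠ v) :
    (E.bag v ∩ E.bag (E.anchor A v) ∩ A).Nonempty := by
  cases hp : E.par v with
  | none => exact absurd (E.anchor_none A hp) h
  | some p =>
    rcases E.anchor_some A hp with ⟨h1, h2⟩ | ⟨-, h2⟩
    · rwa [h2]
    · exact absurd h2 h

theorem anchor_anchor (v : V) : E.anchor A (E.anchor A v) = E.anchor A v := by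
  induction hn : E.rank v using Nat.strong_induction_on generalizing v with
  | _ n ih =>
    cases hp : E.par v with
    | none => rw [E.anchor_none A hp, E.anchor_none A hp]
    | some p =>
      rcases E.anchor_some A hp with ⟨-, h2⟩ | ⟨-, h2⟩
      · rw [h2]; exact ih _ (hn ▸ E.rank_par hp) p rfl
      · rw [h2, h2]

theorem anchor_of_mem_bag {u x : V} (hu : u ∈ E.bag x) (hA : u ∈ A) :
    E.anchor A u = E.anchor A x ∨ ∃ p, E.par (E.anchor A x) = some p ∧
      E.anchor A u = E.anchor A p ∧ E.anchor A u ≠ E.anchor A x ∧ u ∈ E.bag (E.anchor A x) := by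
  induction hn : E.rank x using Nat.strong_induction_on generalizing x with
  | _ n ih =>
    rcases eq_or_ne u x with rfl | hux
    · exact Or.inl rfl
    cases hp : E.par x with
    | none => exact absurd (E.bag_none hp hu) hux
    | some p =>
      have hup := E.bag_par hp hu hux
      have ihp := ih _ (hn ▸ E.rank_par hp) hup rfl
      rcases E.anchor_some A hp with ⟨-, h2⟩ | ⟨h1, h2⟩
      · rw [h2]; exact ihp
      · have h3 : E.anchor A u = E.anchor A p :=
          ihp.resolve_right fun ⟨_, _, _, _, h⟩ => h1 ⟨u, ⟨hu, h⟩, hA⟩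
        by_cases h4 : E.anchor A u = E.anchor A x
        · exact Or.inl h4
        · refine Or.inr ⟨p, ?_, h3, h4, ?_⟩
          · rw [h2]; exact hp
          · rw [h2]; exact hu

end ElimStruct

/-- The number of labels per bag obtained from bags coloured with few colours. -/
def labelBound : ℕ → ℕ
  | 0 => 0
  | M + 1 => 2 * (M + 1 + labelBound M)

theorem ElimStruct.exists_labelling {V : Type} [Fintype V] {G : SimpleGraph V} (E : ElimStruct G)
    (d : ℕ∞) (M : ℕ) : ∀ A : Set V,
    (∀ x, ∃ col : V → V, (col '' (E.bag x ∩ A)).ncard ≤ M ∧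
      ∀ u ∈ E.bag x ∩ A, ∀ w ∈ E.bag x ∩ A, col u = col w → G.edist u w ≤ d) →
    ∃ (Λ : Type) (l : V → Λ), (∀ u ∈ A, ∀ w ∈ A, l u = l w → G.edist u w ≤ d + d + d) ∧
      ∀ x, (l '' (E.bag x ∩ A)).ncard ≤ labelBound M := by
  classical
  induction M with
  | zero =>
    intro A hA
    have hempty : A = ∅ := by
      rw [Set.eq_empty_iff_forall_notMem]
      intro x hx
      obtain ⟨col, h, -⟩ := hA x
      rw [Nat.le_zero, Set.ncard_eq_zero (Set.toFinite _), Set.image_eq_empty] at h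
      have : x ∈ E.bag x ∩ A := ⟨E.mem_self x, hx⟩
      rw [h] at this
      exact this
    subst hempty
    exact ⟨Unit, fun _ => (), by simp, by simp⟩
  | succ M ih =>
    intro A hA
    choose col hcol hcold using hA
    set a := E.anchor A with ha
    let near : V → Prop := fun u => ∃ w ∈ E.bag (a u) ∩ A, G.edist u w ≤ d
    let far : V → Set V := fun y => {u | u ∈ A ∧ a u = y ∧ ¬ near u}
    have hanch : ∀ x, a x ≠ x → (col x '' (E.bag x ∩ far (a x))).ncard ≤ M := by
      intro x hx
      obtain ⟨w, ⟨hwx, hwa⟩, hwA⟩ := E.nonempty_of_anchor_ne A hx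
      have hsub : col x '' (E.bag x ∩ far (a x)) ⊆ (col x '' (E.bag x ∩ A)) \ {col x w} := by
        rintro _ ⟨u, ⟨hux, huA, hau, hnear⟩, rfl⟩
        refine ⟨⟨u, ⟨hux, huA⟩, rfl⟩, fun h => hnear ⟨w, ?_, ?_⟩⟩
        · rw [hau]; exact ⟨hwa, hwA⟩
        · exact hcold x u ⟨hux, huA⟩ w ⟨hwx, hwA⟩ h
      have h1 := Set.ncard_le_ncard hsub (Set.toFinite _)
      have hmem : col x w ∈ col x '' (E.bag x ∩ A) := ⟨w, ⟨hwx, hwA⟩, rfl⟩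
      rw [Set.ncard_sdiff_singleton_of_mem hmem] at h1
      have h2 := hcol x
      omega
    have hself : ∀ y, E.bag y ∩ far y = ∅ := by
      intro y
      rw [Set.eq_empty_iff_forall_notMem]
      rintro u ⟨huy, huA, hau, hnear⟩
      refine hnear ⟨u, ?_, by simp⟩
      rw [hau]; exact ⟨huy, huA⟩
    have hanch' : ∀ x y, a x = y → (col x '' (E.bag x ∩ far y)).ncard ≤ M := by
      rintro x _ rfl
      rcases eq_or_ne (a x) x with h | h
      · rw [h, hself, Set.image_empty, Set.ncard_empty]; exact Nat.zero_le _
      · exact hanch x h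
    have hfar : ∀ y, ∀ x, ∃ col : V → V, (col '' (E.bag x ∩ far y)).ncard ≤ M ∧
        ∀ u ∈ E.bag x ∩ far y, ∀ w ∈ E.bag x ∩ far y, col u = col w → G.edist u w ≤ d := by
      intro y x
      have hfarA : ∀ x, E.bag x ∩ far y ⊆ E.bag x ∩ A := fun x u hu => ⟨hu.1, hu.2.1⟩
      by_cases hxy : a x = y
      · exact ⟨col x, hanch' x y hxy, fun u hu w hw => hcold x u (hfarA x hu) w (hfarA x hw)⟩
      rcases (E.bag x ∩ far y).eq_empty_or_nonempty with h | ⟨u₀, hu₀⟩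
      · exact ⟨col x, by simp [h], by simp [h]⟩
      have key : ∀ u ∈ E.bag x ∩ far y, ∃ p, E.par (a x) = some p ∧ y = a p ∧ u ∈ E.bag p := by
        intro u hu
        have hau : a u = y := hu.2.2.1
        rcases E.anchor_of_mem_bag A hu.1 hu.2.1 with h | ⟨p, hp, h1, h2, h3⟩
        · exact absurd (h.symm.trans hau) hxy
        · refine ⟨p, hp, hau.symm.trans h1, E.bag_par hp h3 ?_⟩
          intro h
          refine h2 ?_
          conv_lhs => rw [h]
          exact E.anchor_anchor A x
      obtain ⟨p, hp, hpy, -⟩ := key u₀ hu₀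
      have hsub : E.bag x ∩ far y ⊆ E.bag p ∩ far y := by
        intro u hu
        obtain ⟨p', hp', -, hup⟩ := key u hu
        obtain rfl : p = p' := by simpa [hp] using hp'
        exact ⟨hup, hu.2⟩
      refine ⟨col p, (Set.ncard_le_ncard (Set.image_mono hsub) (Set.toFinite _)).trans
        (hanch' p y hpy.symm), fun u hu w hw => hcold p u (hfarA p (hsub hu)) w (hfarA p (hsub hw))⟩
    choose Λ l hl hlc using fun y => ih (far y) (hfar y)
    have hwit : ∀ u, ∃ w, near u → w ∈ E.bag (a u) ∩ A ∧ G.edist u w ≤ d := by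
      intro u
      by_cases h : near u
      · obtain ⟨w, h1, h2⟩ := h
        exact ⟨w, fun _ => ⟨h1, h2⟩⟩
      · exact ⟨u, fun h' => absurd h' h⟩
    choose wit hwit using hwit
    let L : V → V × (V ⊕ (Σ y, Λ y)) := fun u =>
      (a u, if near u then Sum.inl (col (a u) (wit u)) else Sum.inr ⟨a u, l (a u) u⟩)
    refine ⟨_, L, ?_, ?_⟩
    · intro u hu w hw huw
      simp only [L, Prod.mk.injEq] at huw
      obtain ⟨haw, huw⟩ := huw
      by_cases h1 : near u
      · by_cases h2 : near w
        · rw [if_pos h1, if_pos h2, haw, Sum.inl.injEq] at huw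
          obtain ⟨hu1, hu2⟩ := hwit u h1
          obtain ⟨hw1, hw2⟩ := hwit w h2
          rw [haw] at hu1
          refine (G.edist_triangle (v := wit w)).trans (add_le_add
            ((G.edist_triangle (v := wit u)).trans (add_le_add hu2 (hcold _ _ hu1 _ hw1 huw))) ?_)
          rwa [SimpleGraph.edist_comm]
        · rw [if_pos h1, if_neg h2] at huw
          exact absurd huw Sum.inl_ne_inr
      · by_cases h2 : near w
        · rw [if_neg h1, if_pos h2] at huw
          exact absurd huw Sum.inr_ne_inl
        · rw [if_neg h1, if_neg h2, haw, Sum.inr.injEq] at huw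
          exact hl (a w) u ⟨hu, haw, h1⟩ w ⟨hw, rfl, h2⟩ (by simpa using huw)
    · intro x
      let B : V → Set (V × (V ⊕ (Σ y, Λ y))) := fun y =>
        (fun c => (y, Sum.inl c)) '' (col y '' (E.bag y ∩ A)) ∪
          (fun c => (y, Sum.inr ⟨y, c⟩)) '' (l y '' (E.bag x ∩ far y))
      have hB : ∀ y, (B y).ncard ≤ M + 1 + labelBound M := fun y =>
        (Set.ncard_union_le _ _).trans (add_le_add
          ((Set.ncard_image_le (Set.toFinite _)).trans (hcol y))
          ((Set.ncard_image_le (Set.toFinite _)).trans (hlc y x)))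
      obtain ⟨y₂, hy₂⟩ : ∃ y₂, ∀ u ∈ E.bag x ∩ A, a u = a x ∨ a u = y₂ := by
        cases hp : E.par (a x) with
        | none =>
          refine ⟨x, fun u hu => ?_⟩
          rcases E.anchor_of_mem_bag A hu.1 hu.2 with h | ⟨p, hp', -⟩
          · exact Or.inl h
          · exact absurd (hp.symm.trans hp') (by simp)
        | some p =>
          refine ⟨a p, fun u hu => ?_⟩
          rcases E.anchor_of_mem_bag A hu.1 hu.2 with h | ⟨p', hp', h, -⟩
          · exact Or.inl h
          · obtain rfl : p = p' := by simpa using hp.symm.trans hp'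
            exact Or.inr h
      have hLB : ∀ u ∈ E.bag x ∩ A, L u ∈ B (a u) := by
        intro u hu
        by_cases h : near u
        · refine Or.inl ⟨col (a u) (wit u), ⟨wit u, (hwit u h).1, rfl⟩, ?_⟩
          simp [L, h]
        · refine Or.inr ⟨l (a u) u, ⟨u, ⟨hu.1, hu.2, rfl, h⟩, rfl⟩, ?_⟩
          simp [L, h]
      have hfin : ∀ y, (B y).Finite := fun y =>
        ((Set.toFinite _).image _).union ((Set.toFinite _).image _)
      have hsub : L '' (E.bag x ∩ A) ⊆ B (a x) ∪ B y₂ := by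
        rintro _ ⟨u, hu, rfl⟩
        have := hLB u hu
        rcases hy₂ u hu with h | h <;> rw [h] at this
        exacts [Or.inl this, Or.inr this]
      refine (Set.ncard_le_ncard hsub ((hfin _).union (hfin _))).trans
        ((Set.ncard_union_le _ _).trans ((add_le_add (hB _) (hB _)).trans ?_))
      rw [labelBound]; omega

theorem connected_induce_of_subset_compIn {V : Type*} {G : SimpleGraph V} {S : Set V} {v : V}
    (hv : v ∈ S) (h : S ⊆ compIn G S v) : (G.induce S).Connected := by
  rw [connected_iff_exists_forall_reachable]
  refine ⟨⟨v, hv⟩, ?_⟩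
  rintro ⟨w, hw⟩
  have key : ∀ w, w ∈ compIn G S v → ∃ hw : w ∈ S, (G.induce S).Reachable ⟨v, hv⟩ ⟨w, hw⟩ := by
    intro w hw
    induction hw with
    | refl => exact ⟨hv, Reachable.refl _⟩
    | @tail b c _ hbc ih =>
      obtain ⟨hb, hr⟩ := ih
      refine ⟨hbc.2.2, hr.trans (Adj.reachable ?_)⟩
      exact hbc.1
  exact (key w (h hw)).2

namespace ElimStruct

variable {V : Type} {G : SimpleGraph V} (E : ElimStruct G)

/-- The tree of an elimination structure: every vertex is joined to its parent, and the vertices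
without a parent are joined to an extra root. -/
def tree : SimpleGraph (Option V) :=
  SimpleGraph.fromRel fun a b => ∃ v, a = some v ∧ b = E.par v

theorem some_ne_par (v : V) : some v ≠ E.par v := fun h => (E.rank_par h.symm).ne rfl

theorem tree_adj_par (v : V) : E.tree.Adj (some v) (E.par v) :=
  (fromRel_adj _ _ _).mpr ⟨E.some_ne_par v, Or.inl ⟨v, rfl, rfl⟩⟩

theorem tree_isTree [Finite V] : E.tree.IsTree := by
  rw [isTree_iff_connected_and_card]
  constructor
  · rw [connected_iff_exists_forall_reachable]
    refine ⟨none, ?_⟩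
    have key : ∀ n v, E.rank v = n → E.tree.Reachable none (some v) := by
      intro n
      induction n using Nat.strong_induction_on with
      | _ n ih =>
        intro v hv
        refine Reachable.trans ?_ (E.tree_adj_par v).symm.reachable
        cases hp : E.par v with
        | none => exact Reachable.refl _
        | some p => exact ih _ (hv ▸ E.rank_par hp) p rfl
    rintro (_ | v)
    · exact Reachable.refl _
    · exact key _ v rfl
  · have hbij : Function.Bijective
        (fun v => (⟨s(some v, E.par v), E.tree_adj_par v⟩ : E.tree.edgeSet)) := by
      constructor
      · intro v w h
        have h' : s(some v, E.par v) = s(some w, E.par w) := congrArg Subtype.val h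
        rcases Sym2.eq_iff.mp h' with ⟨hvw, -⟩ | ⟨h1, h2⟩
        · exact Option.some_injective _ hvw
        · exact absurd (E.rank_par h1.symm) (E.rank_par h2).le.not_gt
      · rintro ⟨e, he⟩
        induction e with
        | _ a b =>
          have hab : E.tree.Adj a b := he
          obtain ⟨-, ⟨v, rfl, rfl⟩ | ⟨v, rfl, rfl⟩⟩ := (fromRel_adj _ _ _).mp hab
          · exact ⟨v, rfl⟩
          · exact ⟨v, Subtype.ext Sym2.eq_swap⟩
    rw [← Nat.card_congr (Equiv.ofBijective _ hbij), Finite.card_option]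

/-- Two vertices in a common bag with the same label. -/
def SameLabel {Λ : Type} (l : V → Λ) (u w : V) : Prop :=
  l u = l w ∧ ∃ x, u ∈ E.bag x ∧ w ∈ E.bag x

/-- The graph obtained by identifying vertices in a common bag with the same label. -/
def quotient {Λ : Type} (l : V → Λ) : SimpleGraph (Quot (E.SameLabel l)) where
  Adj P Q := P ≠ Q ∧ ∃ u w, Quot.mk _ u = P ∧ Quot.mk _ w = Q ∧ G.Adj u w
  symm := ⟨fun _ _ ⟨hne, u, w, hu, hw, h⟩ => ⟨hne.symm, w, u, hw, hu, h.symm⟩⟩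
  loopless := ⟨fun _ h => h.1 rfl⟩

/-- The bags of the quotient graph. -/
def quotientBag {Λ : Type} (l : V → Λ) : Option V → Set (Quot (E.SameLabel l))
  | none => ∅
  | some x => Quot.mk _ '' E.bag x

variable {Λ : Type} (l : V → Λ)

theorem mem_compIn_of_mem_bag {u x : V} (hu : u ∈ E.bag x) :
    some u ∈ compIn E.tree {a | Quot.mk _ u ∈ E.quotientBag l a} (some x) := by
  induction hn : E.rank x using Nat.strong_induction_on generalizing x with
  | _ n ih =>
    rcases eq_or_ne u x with rfl | hux
    · exact mem_compIn_self _ _ _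
    cases hp : E.par x with
    | none => exact absurd (E.bag_none hp hu) hux
    | some p =>
      have hup := E.bag_par hp hu hux
      have hx : Quot.mk _ u ∈ E.quotientBag l (some x) := Set.mem_image_of_mem _ hu
      have hp' : Quot.mk _ u ∈ E.quotientBag l (some p) := Set.mem_image_of_mem _ hup
      refine Relation.ReflTransGen.head ⟨?_, hx, hp'⟩
        (ih _ (hn ▸ E.rank_par hp) hup rfl)
      rw [← hp]
      exact E.tree_adj_par x

theorem quotientBag_connected (Q : Quot (E.SameLabel l)) :
    (E.tree.induce {a | Q ∈ E.quotientBag l a}).Connected := by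
  obtain ⟨u, rfl⟩ := Quot.exists_rep Q
  set S := {a | Quot.mk (E.SameLabel l) u ∈ E.quotientBag l a} with hS
  have key : ∀ w w', Relation.EqvGen (E.SameLabel l) w w' → Quot.mk (E.SameLabel l) w = Quot.mk _ u →
      compIn E.tree S (some w) = compIn E.tree S (some w') := by
    intro w w' h
    induction h with
    | rel w w' h =>
      intro hw
      obtain ⟨-, x, hwx, hwx'⟩ := id h
      have h1 := E.mem_compIn_of_mem_bag l hwx
      have h2 := E.mem_compIn_of_mem_bag l hwx'
      rw [← Quot.sound h, hw] at h2
      rw [hw] at h1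
      rw [compIn_eq h1, compIn_eq h2]
    | refl => exact fun _ => rfl
    | symm w w' h ih =>
      intro hw
      exact (ih ((Quot.eqvGen_sound h).trans hw)).symm
    | trans w w' w'' h _ ih ih' =>
      intro hw
      exact (ih hw).trans (ih' ((Quot.eqvGen_sound h).symm.trans hw))
  refine connected_induce_of_subset_compIn (v := some u) ⟨u, E.mem_self u, rfl⟩ ?_
  rintro (_ | x) hx
  · have hx' : Quot.mk (E.SameLabel l) u ∈ (∅ : Set (Quot (E.SameLabel l))) := hx
    exact absurd hx' (Set.notMem_empty _)
  · obtain ⟨w, hwx, hw⟩ := hx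
    have h1 := E.mem_compIn_of_mem_bag l hwx
    rw [hw] at h1
    rw [key u w (Quot.eqvGen_exact hw.symm) rfl, compIn_eq h1]
    exact mem_compIn_self _ _ _

/-- The tree-decomposition of the quotient graph. -/
def quotientDecomp [Finite V] : TreeDecomp (E.quotient l) (Option V) where
  tree := E.tree
  isTree := E.tree_isTree
  bag := E.quotientBag l
  covers_edge := by
    rintro _ _ ⟨-, u, w, rfl, rfl, h⟩
    rcases E.covers h with h | h
    · exact ⟨some w, ⟨u, h, rfl⟩, ⟨w, E.mem_self w, rfl⟩⟩
    · exact ⟨some u, ⟨u, E.mem_self u, rfl⟩, ⟨w, h, rfl⟩⟩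
  covers_vertex := by
    intro Q
    obtain ⟨u, rfl⟩ := Quot.exists_rep Q
    exact ⟨some u, u, E.mem_self u, rfl⟩
  bags_connected := E.quotientBag_connected l

theorem treewidth_quotient_le [Fintype V] {m : ℕ} (h : ∀ x, (l '' E.bag x).ncard ≤ m) :
    treewidth (E.quotient l) ≤ m := by
  refine Nat.sInf_le ⟨Option V, inferInstance, E.quotientDecomp l, ?_⟩
  rintro (_ | x)
  · exact (Set.ncard_empty _).trans_le (Nat.zero_le _)
  · refine le_trans ?_ ((h x).trans (Nat.le_succ m))
    have hinj : Set.InjOn (Quot.lift l fun _ _ h => h.1)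
        (Quot.mk (E.SameLabel l) '' E.bag x) := by
      rintro _ ⟨u, hu, rfl⟩ _ ⟨w, hw, rfl⟩ huw
      exact Quot.sound ⟨huw, x, hu, hw⟩
    have := hinj.ncard_image
    rw [Set.image_image] at this
    exact this.ge

theorem edist_quotient_le (u v : V) :
    (E.quotient l).edist (Quot.mk _ u) (Quot.mk _ v) ≤ G.edist u v := by
  rcases eq_or_ne (G.edist u v) ⊤ with h | h
  · rw [h]; exact le_top
  obtain ⟨p, hp⟩ := exists_walk_of_edist_ne_top h
  rw [← hp]
  clear hp h
  induction p with
  | nil => simp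
  | @cons u v w hadj p ih =>
    refine ((E.quotient l).edist_triangle (v := Quot.mk _ v)).trans ?_
    rw [Walk.length_cons, Nat.cast_add, add_comm]
    refine add_le_add ih ?_
    rw [Nat.cast_one, edist_le_one_iff_adj_or_eq]
    by_cases h : (Quot.mk (E.SameLabel l) u) = Quot.mk _ v
    · exact Or.inr h
    · exact Or.inl ⟨h, u, v, rfl, rfl, hadj⟩

theorem edist_le_quotient {D : ℕ} (hD : ∀ u w, l u = l w → G.edist u w ≤ D) (u v : V) :
    G.edist u v ≤ (D + 1 : ℕ) * (E.quotient l).edist (Quot.mk _ u) (Quot.mk _ v) + D := by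
  have hmk : ∀ u w, Quot.mk (E.SameLabel l) u = Quot.mk _ w → G.edist u w ≤ D := fun u w h =>
    hD u w (congrArg (Quot.lift l fun _ _ h => h.1) h)
  have key : ∀ P Q (p : (E.quotient l).Walk P Q), ∀ u v, Quot.mk _ u = P → Quot.mk _ v = Q →
      G.edist u v ≤ (((D + 1) * p.length + D : ℕ) : ℕ∞) := by
    intro P Q p
    induction p with
    | nil =>
      intro u v hu hv
      simpa using hmk u v (hu.trans hv.symm)
    | cons hadj p ih =>
      intro u v hu hv
      obtain ⟨-, u', w', hu', hw', hadj'⟩ := id hadj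
      have h1 := hmk u u' (hu.trans hu'.symm)
      have h2 := ih w' v hw' hv
      have h3 : G.edist u' w' ≤ 1 := edist_le_one_iff_adj_or_eq.mpr (Or.inl hadj')
      refine (G.edist_triangle (v := w')).trans ((add_le_add
        ((G.edist_triangle (v := u')).trans (add_le_add h1 h3)) h2).trans ?_)
      rw [Walk.length_cons]
      have : (D + 1) * (p.length + 1) + D = (D + 1) + ((D + 1) * p.length + D) := by ring
      rw [this]
      push_cast
      exact le_rfl
  rcases eq_or_ne ((E.quotient l).edist (Quot.mk _ u) (Quot.mk _ v)) ⊤ with h | h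
  · rw [h, ENat.mul_top (by simp), top_add]; exact le_top
  obtain ⟨p, hp⟩ := exists_walk_of_edist_ne_top h
  rw [← hp]
  exact_mod_cast key _ _ p u v rfl rfl

theorem isQuasiIsometry_quotient {D : ℕ} (hD : ∀ u w, l u = l w → G.edist u w ≤ D) :
    IsQuasiIsometry (D + 1) G (E.quotient l) (Quot.mk _) := by
  refine ⟨fun u v => ⟨?_, ?_⟩, fun Q => ?_⟩
  · have h := ENat.toENNReal_le.mpr (E.edist_le_quotient l hD u v)
    rw [ENat.toENNReal_add, ENat.toENNReal_mul, ENat.toENNReal_coe, ENat.toENNReal_coe] at h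
    rw [tsub_le_iff_right, mul_comm, ← div_eq_mul_inv]
    refine ENNReal.div_le_of_le_mul' (h.trans ?_)
    rw [mul_add]
    gcongr
    norm_cast
    nlinarith
  · have h := ENat.toENNReal_le.mpr (E.edist_quotient_le l u v)
    refine h.trans (le_add_right ?_)
    refine le_mul_of_one_le_left zero_le ?_
    norm_cast
    omega
  · obtain ⟨u, rfl⟩ := Quot.exists_rep Q
    exact ⟨u, by simp⟩

end ElimStruct

/-- For all `k, t` there exist `k', q` such that every `K_{t,t}`-free finite graph all of whose
induced subgraphs admit `(k, 1)`-balanced separators is `q`-quasi-isometric to a graph of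
treewidth at most `k'`. -/
theorem quasiIsometric_of_balancedSeparators (k t : ℕ) :
    ∃ k' q : ℕ, ∀ (V : Type) (_ : Fintype V) (G : SimpleGraph V),
      IsEmpty (completeBipartiteGraph (Fin t) (Fin t) ↪g G) →
      (∀ A : Set V, AdmitsBalancedSeparators (G.induce A) k 1) →
      ∃ (W : Type) (_ : Fintype W) (H : SimpleGraph W) (φ : V → W),
        treewidth H ≤ k' ∧ IsQuasiIsometry q G H φ := by
  obtain ⟨p, hp⟩ := exists_elimStruct k t
  refine ⟨labelBound p, 12 + 1, fun V _ G hfree hsep => ?_⟩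
  obtain ⟨E, hE⟩ := hp V ‹_› G hfree hsep
  obtain ⟨Λ, l, hl, hlc⟩ := E.exists_labelling 4 p Set.univ (by simpa using hE)
  refine ⟨Quot (E.SameLabel l), Fintype.ofFinite _, E.quotient l, Quot.mk _, ?_, ?_⟩
  · exact E.treewidth_quotient_le l (by simpa using hlc)
  · refine E.isQuasiIsometry_quotient l fun u w h => ?_
    refine (hl u (Set.mem_univ u) w (Set.mem_univ w) h).trans ?_
    norm_num
end
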